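/- arXiv:0711.0830 — 8 statements merged into one kernel-verified Lean document; each statement's English description precedes it below -/
import Mathlib

section
/- Let n ≥ 2 and let M ∈ SL(n,ℤ) have characteristic polynomial irreducible over ℚ. Then M is integer conjugate to a Hessenberg matrix H ∈ SL(n,ℤ) of positive Hessenberg complexity (i.e., all subdiagonal entries H (j+1) j, j = 1,…,n−1, are nonzero). -/
open Matrix Polynomial

/-- An n×n integer matrix is (upper) Hessenberg if `M i j = 0` whenever `i > j+1`
(0-based indices). -/
def IsHessenberg {n : ℕ} (M : Matrix (Fin n) (Fin n) ℤ) : Prop :=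
  ∀ i j : Fin n, (j : ℕ) + 1 < (i : ℕ) → M i j = 0

/-- The subdiagonal entry `M (j+1) j` (0-based `j`), or `0` if out of range. -/
def subdiag {n : ℕ} (M : Matrix (Fin n) (Fin n) ℤ) (j : ℕ) : ℤ :=
  if h : j + 1 < n then M ⟨j + 1, h⟩ ⟨j, Nat.lt_of_succ_lt h⟩ else 0

/-- Hessenberg complexity `ς(M) = ∏_{j=1}^{n-1} |M (j+1) j|^(n-j)` (1-based). -/
def hessComplexity {n : ℕ} (M : Matrix (Fin n) (Fin n) ℤ) : ℤ :=
  ∏ j ∈ Finset.range (n - 1), |subdiag M j| ^ (n - 1 - j)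

/-- Integer conjugacy: `X * A * X⁻¹ = B` for some `X ∈ GL(n, ℤ)`. -/
def IntegerConjugate {n : ℕ} (A B : Matrix (Fin n) (Fin n) ℤ) : Prop :=
  ∃ X : Matrix (Fin n) (Fin n) ℤ, IsUnit X.det ∧ X * A = B * X

/-- Perfect Hessenberg matrix: in `SL(n,ℤ)`, Hessenberg, irreducible characteristic
polynomial over ℚ, and `0 ≤ M i j < M (j+1) j` for `1 ≤ i ≤ j ≤ n-1` (1-based). -/
def IsPerfect {n : ℕ} (M : Matrix (Fin n) (Fin n) ℤ) : Prop :=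
  M.det = 1 ∧ IsHessenberg M ∧
  Irreducible ((M.charpoly).map (Int.castRingHom ℚ)) ∧
  ∀ i j : Fin n, i ≤ j → (j : ℕ) + 1 < n → 0 ≤ M i j ∧ M i j < subdiag M (j : ℕ)

/-- A perfect Hessenberg matrix is reduced if its Hessenberg complexity is minimal
among all perfect Hessenberg matrices integer conjugate to it. -/
def IsReducedHess {n : ℕ} (W : Matrix (Fin n) (Fin n) ℤ) : Prop :=
  IsPerfect W ∧ ∀ M : Matrix (Fin n) (Fin n) ℤ, IsPerfect M → IntegerConjugate W M →
    hessComplexity W ≤ hessComplexity M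

/-- One elementary Euclidean step, iterated: the entry `v q` is cleared against `v p` by a
unimodular matrix that acts only on the coordinates `p` and `q`. -/
theorem exists_unimodular_clear_entry {n : ℕ} {p q : Fin n} (hpq : p ≠ q) (v : Fin n → ℤ) :
    ∃ U : Matrix (Fin n) (Fin n) ℤ, IsUnit U.det ∧
      (∀ w : Fin n → ℤ, w p = 0 → w q = 0 → U *ᵥ w = w) ∧
      (∀ r, r ≠ p → r ≠ q → (U *ᵥ v) r = v r) ∧ (U *ᵥ v) q = 0 := by
  induction h : (v q).natAbs using Nat.strong_induction_on generalizing v with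
  | _ d ih =>
    by_cases hq : v q = 0
    · exact ⟨1, by simp, by simp, by simp, by simpa using hq⟩
    set T : Matrix (Fin n) (Fin n) ℤ :=
      (Equiv.swap p q).permMatrix ℤ * transvection p q (-(v p / v q)) with hT
    have hTv (w : Fin n → ℤ) :
        T *ᵥ w = (w + Pi.single p (-(v p / v q) * w q)) ∘ Equiv.swap p q := by
      rw [hT, ← mulVec_mulVec, permMatrix_mulVec]
      congr 1
      rw [transvection, add_mulVec, one_mulVec, single_mulVec]
      rfl
    have hTq : (T *ᵥ v) q = v p % v q := by
      rw [hTv]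
      simp only [Function.comp_apply, Equiv.swap_apply_right, Pi.add_apply, Pi.single_eq_same]
      rw [Int.emod_def]
      ring
    have hlt : ((T *ᵥ v) q).natAbs < d := by
      rw [hTq, ← h]
      have h1 := Int.emod_nonneg (v p) hq
      have h2 := Int.emod_lt_abs (v p) hq
      rw [Int.abs_eq_natAbs] at h2
      omega
    obtain ⟨U, hU, hfix, hother, hzero⟩ := ih _ hlt _ rfl
    refine ⟨U * T, ?_, fun w hp hq => ?_, fun r hrp hrq => ?_, ?_⟩
    · rw [det_mul, hT, det_mul, det_permutation, det_transvection_of_ne _ _ hpq, mul_one]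
      exact hU.mul (Units.isUnit _)
    · have hw : T *ᵥ w = w := by
        rw [hTv]
        ext i
        by_cases hip : i = p
        · simp [hip, hp, hq]
        by_cases hiq : i = q
        · simp [hiq, hp, hq]
        simp [Equiv.swap_apply_of_ne_of_ne hip hiq, hq]
      rw [← mulVec_mulVec, hw, hfix w hp hq]
    · rw [← mulVec_mulVec, hother r hrp hrq, hTv]
      simp [Equiv.swap_apply_of_ne_of_ne hrp hrq, hrp]
    · rw [← mulVec_mulVec, hzero]

/-- All entries of a vector below the pivot `m` can be cleared by a unimodular matrix fixing
every vector supported above the pivot. -/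
theorem exists_unimodular_clear_below {n : ℕ} (m : Fin n) (v : Fin n → ℤ) :
    ∃ U : Matrix (Fin n) (Fin n) ℤ, IsUnit U.det ∧
      (∀ w : Fin n → ℤ, (∀ i, m ≤ i → w i = 0) → U *ᵥ w = w) ∧
      ∀ i, m < i → (U *ᵥ v) i = 0 := by
  suffices h : ∀ s : Finset (Fin n), (∀ i ∈ s, m < i) →
      ∃ U : Matrix (Fin n) (Fin n) ℤ, IsUnit U.det ∧
        (∀ w : Fin n → ℤ, (∀ i, m ≤ i → w i = 0) → U *ᵥ w = w) ∧
        ∀ i ∈ s, (U *ᵥ v) i = 0 by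
    simpa using h (Finset.Ioi m) (by simp)
  intro s
  induction s using Finset.induction_on with
  | empty => exact fun _ => ⟨1, by simp, by simp, by simp⟩
  | insert q s hqs ih =>
    intro hs
    obtain ⟨U, hU, hfix, hzero⟩ := ih fun i hi => hs i (Finset.mem_insert_of_mem hi)
    have hmq := hs q (Finset.mem_insert_self q s)
    obtain ⟨V, hV, hVfix, hVother, hVzero⟩ := exists_unimodular_clear_entry hmq.ne (U *ᵥ v)
    refine ⟨V * U, by rw [det_mul]; exact hV.mul hU, fun w hw => ?_, fun i hi => ?_⟩
    · rw [← mulVec_mulVec, hfix w hw, hVfix w (hw m le_rfl) (hw q hmq.le)]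
    · rw [← mulVec_mulVec]
      rcases Finset.mem_insert.mp hi with rfl | his
      · exact hVzero
      · rw [hVother i (hs i hi).ne' (fun h => hqs (h ▸ his)), hzero i his]

/-- Every integer matrix is integer conjugate to a Hessenberg matrix. -/
theorem exists_integerConjugate_isHessenberg {n : ℕ} (M : Matrix (Fin n) (Fin n) ℤ) :
    ∃ H : Matrix (Fin n) (Fin n) ℤ, IsHessenberg H ∧ IntegerConjugate M H := by
  suffices h : ∀ k : ℕ, ∃ H : Matrix (Fin n) (Fin n) ℤ,
      (∀ i j : Fin n, (j : ℕ) < k → (j : ℕ) + 1 < (i : ℕ) → H i j = 0) ∧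
        IntegerConjugate M H by
    obtain ⟨H, hH, hc⟩ := h n
    exact ⟨H, fun i j => hH i j j.isLt, hc⟩
  intro k
  induction k with
  | zero => exact ⟨M, by simp, 1, by simp, by simp⟩
  | succ k ih =>
    obtain ⟨H, hH, X, hX, hXM⟩ := ih
    by_cases hk : k + 1 < n
    swap
    · exact ⟨H, fun i j _ hij => hH i j (by omega) hij, X, hX, hXM⟩
    obtain ⟨U, hU, hfix, hzero⟩ :=
      exists_unimodular_clear_below ⟨k + 1, hk⟩ (H.col ⟨k, by omega⟩)
    have hinv : U⁻¹ * U = 1 := nonsing_inv_mul U hU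
    refine ⟨U * H * U⁻¹, fun i j hj hij => ?_, U * X, by rw [det_mul]; exact hU.mul hX, ?_⟩
    · have hsingle : U⁻¹ *ᵥ Pi.single j 1 = Pi.single j 1 := by
        conv_lhs => rw [← hfix (Pi.single j 1) fun i hi => by
          have : i ≠ j := by rintro rfl; simp [Fin.le_def] at hi; omega
          simp [this]]
        rw [mulVec_mulVec, hinv, one_mulVec]
      have hcol : (U * H * U⁻¹) i j = (U *ᵥ H.col j) i := by
        rw [← mulVec_single_one H, mulVec_mulVec, ← hsingle, mulVec_mulVec, mulVec_single_one]
        rfl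
      rw [hcol]
      rcases (Nat.lt_succ_iff_lt_or_eq.mp hj) with hjk | hjk
      · rw [hfix (H.col j) fun r hr => hH r j hjk (by simp [Fin.le_def] at hr; omega)]
        exact hH i j hjk hij
      · rw [show j = ⟨k, by omega⟩ from Fin.ext hjk]
        exact hzero i (by simp only [Fin.lt_def]; omega)
    · rw [Matrix.mul_assoc, hXM, Matrix.mul_assoc _ U⁻¹, ← Matrix.mul_assoc U⁻¹, hinv,
        Matrix.one_mul, Matrix.mul_assoc]

/-- The characteristic polynomial of a block triangular matrix is the product of those of the
diagonal blocks. -/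
theorem charpoly_eq_mul_of_twoBlockTriangular {m R : Type*} [Fintype m] [DecidableEq m]
    [CommRing R] (A : Matrix m m R) (p : m → Prop) [DecidablePred p]
    (h : ∀ i, ¬p i → ∀ j, p j → A i j = 0) :
    A.charpoly = (toSquareBlockProp A p).charpoly *
      (toSquareBlockProp A fun i => ¬p i).charpoly := by
  have hblock (q : m → Prop) [DecidablePred q] :
      toSquareBlockProp A.charmatrix q = (toSquareBlockProp A q).charmatrix := by
    ext1 i j
    simp [toSquareBlockProp, charmatrix_apply, diagonal_apply, Subtype.ext_iff]
  rw [charpoly, twoBlockTriangular_det _ p, hblock, hblock, charpoly, charpoly]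
  intro i hi j hj
  have hij : i ≠ j := by rintro rfl; exact hi hj
  simp [charmatrix_apply_ne _ _ _ hij, h i hi j hj]

/-- A matrix over a field with a proper nontrivial invariant coordinate subspace has reducible
characteristic polynomial. -/
theorem not_irreducible_charpoly_of_twoBlockTriangular {m K : Type*} [Fintype m]
    [DecidableEq m] [Field K] (A : Matrix m m K) (p : m → Prop) [DecidablePred p]
    (h : ∀ i, ¬p i → ∀ j, p j → A i j = 0) (hp : ∃ i, p i) (hp' : ∃ i, ¬p i) :
    ¬Irreducible A.charpoly := by
  intro hirr
  obtain ⟨i, hi⟩ := hp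
  obtain ⟨j, hj⟩ := hp'
  have hcard (q : m → Prop) [DecidablePred q] (i : m) (hi : q i) :
      ¬IsUnit (toSquareBlockProp A q).charpoly := by
    intro hu
    have h0 := natDegree_eq_zero_of_isUnit hu
    rw [charpoly_natDegree_eq_dim] at h0
    exact (Fintype.card_eq_zero_iff.mp h0).elim ⟨i, hi⟩
  rcases hirr.isUnit_or_isUnit (charpoly_eq_mul_of_twoBlockTriangular A p h) with hu | hu
  · exact hcard p i hi hu
  · exact hcard (fun i => ¬p i) j hj hu

theorem IntegerConjugate.charpoly_eq {n : ℕ} {A B : Matrix (Fin n) (Fin n) ℤ}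
    (h : IntegerConjugate A B) : B.charpoly = A.charpoly := by
  obtain ⟨X, hX, hXA⟩ := h
  obtain ⟨u, rfl⟩ := (isUnit_iff_isUnit_det X).mpr hX
  rw [← charpoly_units_conj u A, hXA, Matrix.mul_assoc, mul_nonsing_inv _ hX, Matrix.mul_one]

/-- Subdiagonal entries of a Hessenberg matrix with irreducible characteristic polynomial
are nonzero. -/
theorem IsHessenberg.subdiag_ne_zero {n : ℕ} {H : Matrix (Fin n) (Fin n) ℤ}
    (hH : IsHessenberg H) (hirr : Irreducible (H.charpoly.map (Int.castRingHom ℚ)))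
    {k : ℕ} (hk : k + 1 < n) : subdiag H k ≠ 0 := by
  intro h0
  rw [subdiag, dif_pos hk] at h0
  rw [← charpoly_map] at hirr
  refine not_irreducible_charpoly_of_twoBlockTriangular _ (fun i : Fin n => (i : ℕ) ≤ k) ?_
    ⟨⟨k, by omega⟩, le_rfl⟩ ⟨⟨k + 1, hk⟩, by simp⟩ hirr
  intro i hi j hj
  suffices H i j = 0 by simp [this]
  by_cases hij : (j : ℕ) + 1 < i
  · exact hH i j hij
  · obtain rfl : i = ⟨k + 1, hk⟩ := Fin.ext (by simp only; omega)
    rw [show j = ⟨k, by omega⟩ from Fin.ext (by simp only at hij ⊢; omega)]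
    exact h0

/-- Any `M ∈ SL(n,ℤ)` (n ≥ 2) with characteristic polynomial irreducible
over ℚ is integer conjugate to a Hessenberg matrix in `SL(n,ℤ)` of positive Hessenberg
complexity (all subdiagonal entries nonzero). -/
theorem statement0 (n : ℕ) (hn : 2 ≤ n) (M : Matrix (Fin n) (Fin n) ℤ)
    (hdet : M.det = 1)
    (hirr : Irreducible ((M.charpoly).map (Int.castRingHom ℚ))) :
    ∃ H : Matrix (Fin n) (Fin n) ℤ, H.det = 1 ∧ IsHessenberg H ∧
      (∀ j : ℕ, j + 1 < n → subdiag H j ≠ 0) ∧ IntegerConjugate M H := by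
  obtain ⟨H, hH, hc⟩ := exists_integerConjugate_isHessenberg M
  have hchar := hc.charpoly_eq
  refine ⟨H, ?_, hH, fun j hj => hH.subdiag_ne_zero (hchar ▸ hirr) hj, hc⟩
  rw [det_eq_sign_charpoly_coeff, hchar, ← det_eq_sign_charpoly_coeff, hdet]
end

section
/- Let n ≥ 2, let A ∈ SL(n,ℤ) have characteristic polynomial irreducible over ℚ, and let v ∈ ℤⁿ be a primitive vector (the gcd of its coordinates is 1). Then there exists a unique ℤ-basis (g₁,…,gₙ) of ℤⁿ (i.e., the matrix G with columns g₁,…,gₙ lies in GL(n,ℤ)) such that: (1) g₁ = v; (2) for each i = 1,…,n, gᵢ lies in the real span of v, Av, A²v, …, A^{i−1}v; (3) the matrix G⁻¹AG of A in this basis is a perfect Hessenberg matrix. -/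
open Matrix Polynomial

/-- A primitive integer vector is the first column of a unimodular matrix. -/
theorem exists_isUnit_det_of_gcd_eq_one {m : ℕ} (w : Fin (m + 1) → ℤ)
    (hw : Finset.univ.gcd w = 1) :
    ∃ U : Matrix (Fin (m + 1)) (Fin (m + 1)) ℤ, IsUnit U.det ∧ ∀ i, U i 0 = w i := by
  obtain ⟨c, hc⟩ := Finset.gcd_eq_sum_mul Finset.univ w
  let f : (Fin (m + 1) → ℤ) →ₗ[ℤ] ℤ := Fintype.linearCombination ℤ c
  have hfw : f w = 1 := by
    rw [← hw, hc]
    rfl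
  let r := Module.finrank ℤ (LinearMap.ker f)
  let b : Module.Basis (Fin r) ℤ (LinearMap.ker f) := Module.finBasis ℤ _
  let B := Module.Basis.mkFinCons w b
    (fun a x hx h => by
      have := congrArg f h
      rwa [map_add, map_smul, hfw, LinearMap.mem_ker.1 hx, map_zero, smul_eq_mul, mul_one,
        add_zero] at this)
    (fun z => ⟨-f z, by
      rw [LinearMap.mem_ker, map_add, map_smul, hfw, smul_eq_mul, mul_one, add_neg_cancel]⟩)
  have hr : r = m := by
    simpa using (Module.finrank_eq_card_basis B).symm
  let B' := B.reindex (finCongr (congrArg (· + 1) hr))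
  refine ⟨(Pi.basisFun ℤ (Fin (m + 1))).toMatrix B', ?_, fun i => ?_⟩
  · exact (Pi.basisFun ℤ (Fin (m + 1))).isUnit_det B'
  · simp [B', B, Module.Basis.toMatrix_apply]

/-- A vector whose coordinates from `k` on are coprime is column `k` of a unimodular matrix
whose previous columns are standard basis vectors. -/
theorem exists_isUnit_det_extending {n k : ℕ} (hk : k < n) (t : Fin n → ℤ)
    (ht : (Finset.univ.filter fun i : Fin n => k ≤ (i : ℕ)).gcd t = 1) :
    ∃ T : Matrix (Fin n) (Fin n) ℤ, IsUnit T.det ∧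
      (∀ i j : Fin n, (j : ℕ) < k → T i j = (1 : Matrix (Fin n) (Fin n) ℤ) i j) ∧
      ∀ i, T i ⟨k, hk⟩ = t i := by
  obtain ⟨m, rfl⟩ : ∃ m, n = k + (m + 1) := ⟨n - k - 1, by omega⟩
  obtain ⟨U, hU, hUw⟩ := exists_isUnit_det_of_gcd_eq_one (fun i => t (Fin.natAdd k i)) (by
    rw [← ht]
    refine dvd_antisymm_of_normalize_eq Finset.normalize_gcd Finset.normalize_gcd
      (Finset.dvd_gcd fun i hi => ?_) (Finset.dvd_gcd fun i _ => Finset.gcd_dvd (by simp))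
    obtain ⟨i, rfl⟩ : ∃ j, Fin.natAdd k j = i :=
      ⟨⟨i - k, by omega⟩, by
        ext; exact Nat.add_sub_cancel' (Finset.mem_filter.1 hi).2⟩
    exact Finset.gcd_dvd (f := fun i => t (Fin.natAdd k i)) (Finset.mem_univ _))
  let e : Fin k ⊕ Fin (m + 1) ≃ Fin (k + (m + 1)) := finSumFinEquiv
  let B : Matrix (Fin k) (Fin (m + 1)) ℤ := Matrix.of fun i _ => t (Fin.castAdd (m + 1) i)
  have hcol : (⟨k, hk⟩ : Fin (k + (m + 1))) = Fin.natAdd k 0 := by ext; simp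
  refine ⟨(Matrix.fromBlocks 1 B 0 U).submatrix e.symm e.symm, ?_, fun i j hj => ?_, fun i => ?_⟩
  · rwa [Matrix.det_submatrix_equiv_self, Matrix.det_fromBlocks_zero₂₁, Matrix.det_one, one_mul]
  · obtain ⟨j, rfl⟩ : ∃ l, Fin.castAdd (m + 1) l = j := ⟨⟨j, hj⟩, rfl⟩
    refine Fin.addCases (fun i => ?_) (fun i => ?_) i
    · simp [e, Matrix.one_apply]
    · simp [e, Matrix.one_apply, Fin.ext_iff]
      omega
  · rw [hcol]
    refine Fin.addCases (fun i => ?_) (fun i => ?_) i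
    · simp [e, B]
    · simp [e, hUw]

/-- A column of `T * X` when `T` fixes the standard basis vectors before `k` and the column of `X`
vanishes after `k`. -/
theorem mul_apply_of_eq_one_of_lt {n : ℕ} {T X : Matrix (Fin n) (Fin n) ℤ} {k j : Fin n}
    (hT : ∀ i l : Fin n, l < k → T i l = (1 : Matrix (Fin n) (Fin n) ℤ) i l)
    (hX : ∀ l, k < l → X l j = 0) (i : Fin n) :
    (T * X) i j = (if i = k then 0 else X i j) + T i k * X k j := by
  have h : ∀ l, T i l * X l j =
      (if i = l then (if i = k then 0 else X i j) else 0) + if l = k then T i k * X k j else 0 := by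
    intro l
    rcases lt_trichotomy l k with hl | rfl | hl
    · rw [hT i l hl, Matrix.one_apply]
      by_cases hil : i = l
      · subst hil; simp [hl.ne]
      · simp [hil, hl.ne]
    · by_cases hil : i = l <;> simp [hil]
    · by_cases hil : i = l
      · subst hil; simp [hX i hl, hl.ne']
      · simp [hil, hX l hl, hl.ne']
  rw [Matrix.mul_apply, Finset.sum_congr rfl fun l _ => h l, Finset.sum_add_distrib]
  simp

theorem exists_ne_zero_of_irreducible_charpoly {n k : ℕ} (hk0 : 0 < k) (hk : k < n)
    {H : Matrix (Fin n) (Fin n) ℤ} (hH : Irreducible (H.charpoly.map (Int.castRingHom ℚ))) :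
    ∃ i j : Fin n, (j : ℕ) < k ∧ k ≤ (i : ℕ) ∧ H i j ≠ 0 := by
  by_contra! h
  obtain ⟨m, rfl⟩ : ∃ m, n = k + (m + 1) := ⟨n - k - 1, by omega⟩
  let e : Fin k ⊕ Fin (m + 1) ≃ Fin (k + (m + 1)) := finSumFinEquiv
  let H' := Matrix.reindex e.symm e.symm H
  have h21 : H'.toBlocks₂₁ = 0 := by
    ext i j
    exact h _ _ (by simp [e]) (by simp [e])
  have hc : H.charpoly = H'.toBlocks₁₁.charpoly * H'.toBlocks₂₂.charpoly := by
    rw [← Matrix.charpoly_reindex e.symm H, ← Matrix.charpoly_fromBlocks_zero₂₁ _ H'.toBlocks₁₂,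
      ← h21, Matrix.fromBlocks_toBlocks]
  have hpos : ∀ {r : ℕ} (A : Matrix (Fin r) (Fin r) ℤ), 0 < r →
      ¬ IsUnit (A.charpoly.map (Int.castRingHom ℚ)) := fun A hr =>
    Polynomial.not_isUnit_of_natDegree_pos _ (by
      rw [A.charpoly_monic.natDegree_map, Matrix.charpoly_natDegree_eq_dim, Fintype.card_fin]
      exact hr)
  rw [hc, Polynomial.map_mul] at hH
  exact (hH.isUnit_or_isUnit rfl).elim (hpos _ hk0) (hpos _ m.succ_pos)

theorem charpoly_conj_eq {n : ℕ} {M G : Matrix (Fin n) (Fin n) ℤ} (hG : IsUnit G.det) :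
    (G⁻¹ * M * G).charpoly = M.charpoly := by
  rw [Matrix.charpoly_mul_comm, ← mul_assoc, Matrix.mul_nonsing_inv _ hG, one_mul]

theorem mul_apply_congr_right {n : ℕ} (A : Matrix (Fin n) (Fin n) ℤ)
    {B C : Matrix (Fin n) (Fin n) ℤ} {j : Fin n} (h : ∀ l, B l j = C l j) (i : Fin n) :
    (A * B) i j = (A * C) i j := by
  simp only [Matrix.mul_apply, h]

/-- The columns of `H` with index below `k - 1` satisfy the conditions of a perfect Hessenberg
matrix. -/
def IsPerfectBelow {n : ℕ} (k : ℕ) (H : Matrix (Fin n) (Fin n) ℤ) : Prop :=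
  ∀ j : Fin n, (j : ℕ) + 1 < k → (∀ i : Fin n, (j : ℕ) + 1 < (i : ℕ) → H i j = 0) ∧
    ∀ i : Fin n, i ≤ j → 0 ≤ H i j ∧ H i j < subdiag H j

theorem subdiag_eq {n : ℕ} (H : Matrix (Fin n) (Fin n) ℤ) {i j : Fin n} (h : (i : ℕ) = j + 1) :
    subdiag H j = H i j := by
  obtain ⟨i, hi⟩ := i
  subst h
  simp [subdiag, hi]

theorem isPerfect_conj_iff {n : ℕ} {M G : Matrix (Fin n) (Fin n) ℤ} (hdet : M.det = 1)
    (hirr : Irreducible (M.charpoly.map (Int.castRingHom ℚ))) (hG : IsUnit G.det) :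
    IsPerfect (G⁻¹ * M * G) ↔ IsPerfectBelow n (G⁻¹ * M * G) := by
  have hdet' : (G⁻¹ * M * G).det = 1 := by
    rw [Matrix.det_mul_comm, ← mul_assoc, Matrix.mul_nonsing_inv _ hG, one_mul, hdet]
  refine ⟨fun h j hj => ⟨fun i hi => h.2.1 i j hi, fun i hi => h.2.2.2 i j hi hj⟩, fun h =>
    ⟨hdet', fun i j hij => (h j (hij.trans i.isLt)).1 i hij, by rwa [charpoly_conj_eq hG],
      fun i j hij hj => (h j hj).2 i hij⟩⟩

/-- A unimodular change of basis fixing the first vector makes one more column perfect. -/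
theorem IsPerfectBelow.exists_conj_succ {n k : ℕ} (hk0 : 0 < k) (hk : k < n)
    {H : Matrix (Fin n) (Fin n) ℤ} (hirr : Irreducible (H.charpoly.map (Int.castRingHom ℚ)))
    (hH : IsPerfectBelow k H) :
    ∃ T : Matrix (Fin n) (Fin n) ℤ, IsUnit T.det ∧
      (∀ i j : Fin n, (j : ℕ) < k → T i j = (1 : Matrix (Fin n) (Fin n) ℤ) i j) ∧
      IsPerfectBelow (k + 1) (T⁻¹ * H * T) := by
  let p : Fin n := ⟨k - 1, by omega⟩
  let q : Fin n := ⟨k, hk⟩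
  let S := Finset.univ.filter fun i : Fin n => k ≤ (i : ℕ)
  let d := S.gcd fun i => H i p
  obtain ⟨i₀, j₀, hj₀, hi₀, hne⟩ := exists_ne_zero_of_irreducible_charpoly hk0 hk hirr
  obtain rfl : j₀ = p := by
    by_contra hjp
    have : (j₀ : ℕ) ≠ k - 1 := fun h => hjp (Fin.ext h)
    exact hne ((hH j₀ (by omega)).1 i₀ (by omega))
  have hi₀S : i₀ ∈ S := by simp [S, hi₀]
  have hd : 0 < d := lt_of_le_of_ne Finset.Int.finsetGcd_nonneg fun h =>
    hne (Finset.gcd_eq_zero_iff.1 h.symm i₀ hi₀S)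
  obtain ⟨T, hT, hT1, hTk⟩ := exists_isUnit_det_extending hk (fun i => H i p / d)
    (Finset.gcd_div_eq_one hi₀S hne)
  let X : Matrix (Fin n) (Fin n) ℤ := fun i j =>
    if j = p then (if i < q then H i p % d else if i = q then d else 0) else H i j
  have hXp : ∀ i, X i p = if i < q then H i p % d else if i = q then d else 0 :=
    fun i => if_pos rfl
  have hXne : ∀ i j, j ≠ p → X i j = H i j := fun i j h => if_neg h
  have hjp : ∀ j : Fin n, j < q → j ≠ p → (j : ℕ) + 1 < k := fun j hj hne => by
    have h1 : (j : ℕ) < k := hj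
    have h2 : (j : ℕ) ≠ k - 1 := fun h => hne (Fin.ext h)
    omega
  have hTX : ∀ i j, j < q → (T * X) i j = H i j := by
    intro i j hj
    rw [mul_apply_of_eq_one_of_lt (k := q) (fun i l hl => hT1 i l hl)]
    · by_cases hjeq : j = p
      · subst hjeq
        rw [hTk, hXp, hXp, if_neg (lt_irrefl q), if_pos rfl]
        rcases lt_trichotomy i q with hi | rfl | hi
        · rw [if_neg hi.ne, if_pos hi, mul_comm]
          exact Int.emod_add_mul_ediv _ _
        · rw [if_pos rfl, zero_add]
          exact Int.ediv_mul_cancel (Finset.gcd_dvd (by simp [S, q]))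
        · rw [if_neg hi.ne', if_neg hi.not_gt, if_neg hi.ne', zero_add]
          have hi' : k < (i : ℕ) := hi
          exact Int.ediv_mul_cancel (Finset.gcd_dvd (by simp [S, hi'.le]))
      · have hj1 := hjp j hj hjeq
        rw [hXne _ _ hjeq, hXne _ _ hjeq, (hH j hj1).1 q hj1, mul_zero, add_zero]
        split_ifs with hi
        · rw [hi, (hH j hj1).1 q hj1]
        · rfl
    · intro l hl
      by_cases hjeq : j = p
      · rw [hjeq, hXp, if_neg hl.not_gt, if_neg hl.ne']
      · have hj1 := hjp j hj hjeq
        rw [hXne _ _ hjeq, (hH j hj1).1 l (hj1.trans hl)]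
  have hconj : ∀ i j, j < q → (T⁻¹ * H * T) i j = X i j := by
    intro i j hj
    have hcol : ∀ l, (H * T) l j = (T * X) l j := fun l => by
      rw [hTX l j hj, mul_apply_congr_right H (fun r => hT1 r j hj), mul_one]
    rw [mul_assoc, mul_apply_congr_right _ hcol, ← mul_assoc, Matrix.nonsing_inv_mul _ hT, one_mul]
  refine ⟨T, hT, hT1, fun j hj => ?_⟩
  have hjq : j < q := Nat.lt_of_succ_lt_succ hj
  by_cases hjeq : j = p
  · subst hjeq
    rw [subdiag_eq _ (show (q : ℕ) = (p : ℕ) + 1 by simp [p, q]; omega)]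
    refine ⟨fun i hi => ?_, fun i hi => ?_⟩
    · have hi' : q < i := by
        simp only [p] at hi
        exact show k < (i : ℕ) by omega
      rw [hconj _ _ hjq, hXp, if_neg hi'.not_gt, if_neg hi'.ne']
    · rw [hconj _ _ hjq, hconj _ _ hjq, hXp, hXp, if_pos (hi.trans_lt hjq),
        if_neg (lt_irrefl q), if_pos rfl]
      exact ⟨Int.emod_nonneg _ hd.ne', Int.emod_lt_of_pos _ hd⟩
  · have hj1 := hjp j hjq hjeq
    have hs : ((⟨j + 1, hj1.trans hk⟩ : Fin n) : ℕ) = j + 1 := rfl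
    rw [subdiag_eq _ hs]
    have := hH j hj1
    rw [subdiag_eq _ hs] at this
    simpa only [hconj _ _ hjq, hXne _ _ hjeq] using this

theorem exists_isPerfectBelow_conj {n k : ℕ} (hk0 : 0 < k) (hk : k ≤ n)
    {M : Matrix (Fin n) (Fin n) ℤ} (hirr : Irreducible (M.charpoly.map (Int.castRingHom ℚ)))
    {v : Fin n → ℤ} (hv : Finset.univ.gcd v = 1) :
    ∃ G : Matrix (Fin n) (Fin n) ℤ, IsUnit G.det ∧
      (∀ i, G i ⟨0, hk0.trans_le hk⟩ = v i) ∧ IsPerfectBelow k (G⁻¹ * M * G) := by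
  induction k, hk0 using Nat.le_induction with
  | base =>
    obtain ⟨m, rfl⟩ : ∃ m, n = m + 1 := ⟨n - 1, by omega⟩
    obtain ⟨G, hG, hGv⟩ := exists_isUnit_det_of_gcd_eq_one v hv
    exact ⟨G, hG, hGv, fun j hj => by omega⟩
  | succ k hk0 ih =>
    obtain ⟨G, hG, hGv, hP⟩ := ih (Nat.le_of_succ_le hk)
    obtain ⟨T, hT, hT1, hTP⟩ := hP.exists_conj_succ hk0 hk (by rwa [charpoly_conj_eq hG])
    refine ⟨G * T, by rw [Matrix.det_mul]; exact hG.mul hT, fun i => ?_, ?_⟩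
    · rw [mul_apply_congr_right G (fun l => hT1 l _ (Nat.succ_le_iff.1 hk0)), mul_one, hGv]
    · simpa only [Matrix.mul_inv_rev, mul_assoc] using hTP

/-- The columns of a matrix conjugating `M` to a Hessenberg matrix with nonzero subdiagonal lie in
the Krylov subspaces of the first column. -/
theorem IsPerfectBelow.col_mem_span {n : ℕ} {M G H : Matrix (Fin n) (Fin n) ℤ} (hn : 0 < n)
    (hGH : M * G = G * H) (hH : IsPerfectBelow n H) {v : Fin n → ℤ}
    (hv : ∀ k, G k ⟨0, hn⟩ = v k) (i : Fin n) :
    (fun k : Fin n => (G k i : ℝ)) ∈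
      Submodule.span ℝ {w : Fin n → ℝ | ∃ j : ℕ, j ≤ (i : ℕ) ∧
        w = fun k : Fin n => (((M ^ j).mulVec v) k : ℝ)} := by
  let W : ℕ → Submodule ℝ (Fin n → ℝ) := fun i => Submodule.span ℝ
    {w | ∃ j : ℕ, j ≤ i ∧ w = fun k : Fin n => (((M ^ j).mulVec v) k : ℝ)}
  let MR : Matrix (Fin n) (Fin n) ℝ := M.map (Int.castRingHom ℝ)
  have hmono : Monotone W := fun a b hab =>
    Submodule.span_mono fun w ⟨j, hj, hw⟩ => ⟨j, hj.trans hab, hw⟩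
  have hMW : ∀ a, ∀ x ∈ W a, MR.mulVec x ∈ W (a + 1) := by
    intro a x hx
    refine (Submodule.map_span_le MR.mulVecLin _ (W (a + 1))).2 ?_ (Submodule.mem_map_of_mem hx)
    rintro _ ⟨j, hj, rfl⟩
    refine Submodule.subset_span ⟨j + 1, Nat.succ_le_succ hj, ?_⟩
    rw [pow_succ', ← Matrix.mulVec_mulVec]
    ext k
    simp [MR, Matrix.mulVec, dotProduct]
  suffices h : ∀ a (ha : a < n), (fun k : Fin n => (G k ⟨a, ha⟩ : ℝ)) ∈ W a from h i i.isLt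
  intro a
  induction a using Nat.strong_induction_on with
  | _ a ih =>
  intro ha
  rcases a with _ | a
  · exact Submodule.subset_span ⟨0, le_rfl, by simp [hv]⟩
  have ha' : a < n := Nat.lt_of_succ_lt ha
  let p : Fin n := ⟨a, ha'⟩
  let q : Fin n := ⟨a + 1, ha⟩
  obtain ⟨hzero, hbound⟩ := hH p ha
  have hpos : 0 < H q p := by
    have := hbound p le_rfl
    rw [subdiag_eq H (show (q : ℕ) = p + 1 from rfl)] at this
    omega
  have hpos' : (H q p : ℝ) ≠ 0 := by exact_mod_cast hpos.ne'
  have key : (H q p : ℝ) • (fun k : Fin n => (G k q : ℝ)) =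
      MR.mulVec (fun k => (G k p : ℝ)) -
        ∑ l ∈ Finset.univ.erase q, (H l p : ℝ) • fun k : Fin n => (G k l : ℝ) := by
    rw [eq_sub_iff_add_eq, Finset.add_sum_erase Finset.univ
      (fun l => (H l p : ℝ) • fun k : Fin n => (G k l : ℝ)) (Finset.mem_univ q)]
    ext k
    have := congrArg (Int.cast : ℤ → ℝ) (congrFun (congrFun hGH k) p)
    simp only [Matrix.mul_apply, Int.cast_sum, Int.cast_mul] at this
    simp [MR, Matrix.mulVec, dotProduct, this, mul_comm]
  rw [← Submodule.smul_mem_iff _ hpos', key]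
  refine Submodule.sub_mem _ (hMW a _ (ih a a.lt_succ_self ha')) (Submodule.sum_mem _ fun l hl => ?_)
  rcases lt_or_ge q l with hql | hlq
  · simp [hzero l hql]
  · have hlt : (l : ℕ) < a + 1 := lt_of_le_of_ne hlq fun h => (Finset.mem_erase.1 hl).1 (Fin.ext h)
    exact Submodule.smul_mem _ _ (hmono hlt.le (ih l hlt l.isLt))

/-- Comparison of column `p` of two conjugates related by a matrix `U` which fixes the first
`p + 1` basis vectors. -/
theorem IsPerfectBelow.apply_eq_of_mul_eq_mul {n : ℕ} {U H H' : Matrix (Fin n) (Fin n) ℤ} {p q : Fin n}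
    (hpq : (q : ℕ) = p + 1) (hUH : H * U = U * H') (hH' : IsPerfectBelow n H')
    (hU : ∀ i l : Fin n, l < q → U i l = (1 : Matrix (Fin n) (Fin n) ℤ) i l) (i : Fin n) :
    H i p = (if i = q then 0 else H' i p) + U i q * H' q p := by
  rw [← mul_apply_of_eq_one_of_lt hU (fun l hl => (hH' p (hpq ▸ q.isLt)).1 l (hpq ▸ hl)),
    ← hUH, mul_apply_congr_right H (fun l => hU l p (Fin.lt_def.2 (by omega))), mul_one]

/-- A unimodular matrix fixing the first basis vector and conjugating a perfect Hessenberg matrix to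
a perfect Hessenberg matrix is the identity. -/
theorem IsPerfectBelow.eq_one_of_mul_eq_mul {n : ℕ} (hn : 0 < n)
    {U H H' : Matrix (Fin n) (Fin n) ℤ} (hUdet : IsUnit U.det) (hUH : H * U = U * H')
    (hH : IsPerfectBelow n H) (hH' : IsPerfectBelow n H')
    (hU : ∀ i, U i ⟨0, hn⟩ = (1 : Matrix (Fin n) (Fin n) ℤ) i ⟨0, hn⟩) : U = 1 := by
  suffices h : ∀ a (ha : a < n) i, U i ⟨a, ha⟩ = (1 : Matrix (Fin n) (Fin n) ℤ) i ⟨a, ha⟩ from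
    Matrix.ext fun i j => h j j.isLt i
  intro a
  induction a using Nat.strong_induction_on with
  | _ a ih =>
  intro ha
  rcases a with _ | a
  · exact hU
  let p : Fin n := ⟨a, Nat.lt_of_succ_lt ha⟩
  let q : Fin n := ⟨a + 1, ha⟩
  have hpq : (q : ℕ) = p + 1 := rfl
  have hUlt : ∀ i l : Fin n, l < q → U i l = (1 : Matrix (Fin n) (Fin n) ℤ) i l :=
    fun i l hl => ih l hl l.isLt i
  have hVlt : ∀ i l : Fin n, l < q → U⁻¹ i l = (1 : Matrix (Fin n) (Fin n) ℤ) i l := by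
    intro i l hl
    rw [← Matrix.nonsing_inv_mul U hUdet, mul_apply_congr_right _ (fun r => hUlt r l hl), mul_one]
  have hVH : H' * U⁻¹ = U⁻¹ * H := by
    calc H' * U⁻¹ = U⁻¹ * (U * H') * U⁻¹ := by
          rw [← mul_assoc, Matrix.nonsing_inv_mul U hUdet, one_mul]
      _ = U⁻¹ * H := by
          rw [← hUH, mul_assoc, mul_assoc, Matrix.mul_nonsing_inv U hUdet, mul_one]
  have e := IsPerfectBelow.apply_eq_of_mul_eq_mul hpq hUH hH' hUlt
  have e' := IsPerfectBelow.apply_eq_of_mul_eq_mul hpq hVH hH hVlt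
  obtain ⟨hz, hb⟩ := hH p ha
  obtain ⟨hz', hb'⟩ := hH' p ha
  simp only [subdiag_eq _ hpq] at hb hb'
  have hpos : 0 < H q p := (hb p le_rfl).1.trans_lt (hb p le_rfl).2
  have hpos' : 0 < H' q p := (hb' p le_rfl).1.trans_lt (hb' p le_rfl).2
  have heq : H q p = H' q p := Int.dvd_antisymm hpos.le hpos'.le
    (Dvd.intro_left (U⁻¹ q q) (by simpa using (e' q).symm))
    (Dvd.intro_left (U q q) (by simpa using (e q).symm))
  intro i
  change U i q = (1 : Matrix (Fin n) (Fin n) ℤ) i q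
  have ei := e i
  rcases lt_trichotomy i q with hi | rfl | hi
  · have hip : i ≤ p := Nat.le_of_lt_succ hi
    rw [if_neg hi.ne] at ei
    rw [Matrix.one_apply_ne hi.ne]
    have h1 := hb i hip
    have h2 := hb' i hip
    rw [heq] at h1
    have h3 : H i p % H' q p = H' i p % H' q p := by rw [ei, Int.add_mul_emod_self_right]
    rw [Int.emod_eq_of_lt h1.1 h1.2, Int.emod_eq_of_lt h2.1 h2.2] at h3
    have : U i q * H' q p = 0 := by omega
    exact (mul_eq_zero.1 this).resolve_right hpos'.ne'
  · rw [if_pos rfl, zero_add, heq] at ei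
    rw [Matrix.one_apply_eq]
    exact (mul_eq_right₀ hpos'.ne').1 ei.symm
  · rw [if_neg hi.ne', hz i hi, hz' i hi, zero_add] at ei
    rw [Matrix.one_apply_ne hi.ne']
    exact (mul_eq_zero.1 ei.symm).resolve_right hpos'.ne'

/-- For `M ∈ SL(n,ℤ)` (n ≥ 2) with characteristic polynomial irreducible
over ℚ and a primitive integer vector `v`, there is a unique ℤ-basis (the columns of a
matrix `G ∈ GL(n,ℤ)`) with `g₁ = v`, `gᵢ` in the real span of `v, Mv, …, M^{i-1}v`,
and such that the matrix `G⁻¹ M G` of the operator in this basis is perfect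
Hessenberg. -/
theorem statement2 (n : ℕ) (hn : 2 ≤ n) (M : Matrix (Fin n) (Fin n) ℤ)
    (hdet : M.det = 1)
    (hirr : Irreducible ((M.charpoly).map (Int.castRingHom ℚ)))
    (v : Fin n → ℤ) (hv : Finset.univ.gcd v = 1) :
    ∃! G : Matrix (Fin n) (Fin n) ℤ,
      IsUnit G.det ∧
      (∀ k : Fin n, G k ⟨0, by omega⟩ = v k) ∧
      (∀ i : Fin n, (fun k : Fin n => (G k i : ℝ)) ∈
        Submodule.span ℝ {w : Fin n → ℝ | ∃ j : ℕ, j ≤ (i : ℕ) ∧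
          w = fun k : Fin n => (((M ^ j).mulVec v) k : ℝ)}) ∧
      IsPerfect (G⁻¹ * M * G) := by
  have hn0 : 0 < n := by omega
  obtain ⟨G, hG, hGv, hP⟩ := exists_isPerfectBelow_conj hn0 le_rfl hirr hv
  have hmul : ∀ {K : Matrix (Fin n) (Fin n) ℤ}, IsUnit K.det → M * K = K * (K⁻¹ * M * K) :=
    fun {K} hK => by
      rw [← mul_assoc, ← mul_assoc, Matrix.mul_nonsing_inv K hK, one_mul]
  refine ⟨G, ⟨hG, hGv, hP.col_mem_span hn0 (hmul hG) hGv,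
    (isPerfect_conj_iff hdet hirr hG).2 hP⟩, ?_⟩
  rintro K ⟨hK, hKv, -, hKP⟩
  rw [isPerfect_conj_iff hdet hirr hK] at hKP
  have hU : G⁻¹ * K = 1 := by
    refine hP.eq_one_of_mul_eq_mul hn0 ?_ ?_ hKP fun i => ?_
    · rw [Matrix.det_mul]
      exact (Matrix.isUnit_nonsing_inv_det G hG).mul hK
    · calc G⁻¹ * M * G * (G⁻¹ * K) = G⁻¹ * M * (G * G⁻¹) * K := by simp only [mul_assoc]
        _ = G⁻¹ * (M * K) := by rw [Matrix.mul_nonsing_inv G hG, mul_one, mul_assoc]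
        _ = G⁻¹ * K * (K⁻¹ * M * K) := by rw [hmul hK, ← mul_assoc]
    · rw [← Matrix.nonsing_inv_mul G hG]
      exact mul_apply_congr_right _ (fun l => (hKv l).trans (hGv l).symm) i
  rw [← one_mul K, ← Matrix.mul_nonsing_inv G hG, mul_assoc, hU, mul_one]
end

section
/- Let n ≥ 1 and let M and M′ be n×n integer Hessenberg matrices all of whose subdiagonal entries M (j+1) j and M′ (j+1) j (j = 1,…,n−1) are nonzero. If M and M′ have the same first n−1 columns and equal characteristic polynomials, then M = M′. -/
open Matrix Polynomial

namespace Matrix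

/-- The last row of the adjugate does not depend on the last column. -/
theorem adjugate_last_eq_of_forall_castSucc {R : Type*} [CommRing R] {m : ℕ}
    {A B : Matrix (Fin (m + 1)) (Fin (m + 1)) R}
    (h : ∀ i (j : Fin m), A i j.castSucc = B i j.castSucc) :
    A.adjugate (Fin.last m) = B.adjugate (Fin.last m) := by
  ext i
  simp only [adjugate_fin_succ_eq_det_submatrix, Fin.succAbove_last]
  congr 2
  ext k j
  exact h _ j

theorem sum_adjugate_mul {R ι : Type*} [CommRing R] [Fintype ι] [DecidableEq ι]
    (A : Matrix ι ι R) (k j : ι) :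
    ∑ i, A.adjugate k i * A i j = if k = j then A.det else 0 := by
  rw [← mul_apply, adjugate_mul, smul_apply, one_apply, smul_eq_mul, mul_ite, mul_one, mul_zero]

end Matrix

theorem Polynomial.eq_zero_of_sum_mul_C_eq_zero {R ι : Type*} [CommRing R] [IsDomain R]
    [Fintype ι] {a : ι → R[X]} (ha : ∀ i, a i ≠ 0)
    (hdeg : Function.Injective fun i => (a i).degree) {d : ι → R}
    (h : ∑ i, a i * C (d i) = 0) (i : ι) : d i = 0 := by
  have key := degree_sum_eq_of_disjoint (fun i => a i * C (d i)) Finset.univ <| by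
    rintro x ⟨-, hx⟩ y ⟨-, hy⟩ hxy hd
    have hx' : d x ≠ 0 := fun h0 => hx (by simp [h0])
    have hy' : d y ≠ 0 := fun h0 => hy (by simp [h0])
    apply hxy
    apply hdeg
    simpa [degree_mul, degree_C hx', degree_C hy'] using hd
  rw [h, degree_zero, eq_comm, Finset.sup_eq_bot_iff] at key
  have := degree_eq_bot.mp (key i (Finset.mem_univ i))
  simpa [ha i] using this

/-- A row vector of polynomials annihilated by the first columns of the characteristic matrix of a
Hessenberg matrix with nonzero subdiagonal has entries of consecutive degrees. -/
theorem IsHessenberg.degree_eq_of_sum_mul_charmatrix_eq_zero {m : ℕ}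
    {M : Matrix (Fin (m + 1)) (Fin (m + 1)) ℤ} (hM : IsHessenberg M)
    (hsub : ∀ j : Fin m, M j.succ j.castSucc ≠ 0) {a : Fin (m + 1) → ℤ[X]}
    (ha : ∀ j : Fin m, ∑ i, a i * M.charmatrix i j.castSucc = 0) (i : Fin (m + 1)) :
    (a i).degree = (a 0).degree + (i : ℕ) := by
  obtain ⟨k, hk⟩ := i
  induction k using Nat.strong_induction_on with
  | _ k ih =>
    obtain _ | k := k
    · simp
    let j : Fin m := ⟨k, by omega⟩
    have hrec : a j.succ * C (M j.succ j.castSucc) =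
        a j.castSucc * X - ∑ i ∈ Finset.Iic j.castSucc, a i * C (M i j.castSucc) := by
      have hsum : ∑ i, a i * C (M i j.castSucc) =
          ∑ i ∈ Finset.Iic j.castSucc, a i * C (M i j.castSucc) +
            a j.succ * C (M j.succ j.castSucc) := by
        rw [← Finset.sum_subset (Finset.subset_univ (insert j.succ (Finset.Iic j.castSucc))),
          Finset.sum_insert (by simp), add_comm]
        intro i _ hi
        rw [hM i j.castSucc, C_0, mul_zero]
        simp only [Finset.mem_insert, Finset.mem_Iic, not_or, Fin.ext_iff, Fin.le_def,
          Fin.val_succ, Fin.val_castSucc] at hi ⊢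
        omega
      have h := ha j
      simp only [Matrix.charmatrix_apply, mul_sub, Finset.sum_sub_distrib, hsum,
        Matrix.diagonal_apply, mul_ite, mul_zero, Finset.sum_ite_eq', Finset.mem_univ,
        if_true] at h
      linear_combination -h
    have hj : (a j.castSucc).degree = (a 0).degree + (k : ℕ) := ih k (by omega) _
    change (a j.succ).degree = _
    have hC : (a j.succ).degree = (a j.succ * C (M j.succ j.castSucc)).degree := by
      rw [degree_mul, degree_C (hsub j), add_zero]
    by_cases h0 : a 0 = 0
    · have hz (i) (hi : i ∈ Finset.Iic j.castSucc) : a i = 0 := by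
        rw [← degree_eq_bot, ih i (Nat.lt_succ_of_le (Fin.le_def.mp (Finset.mem_Iic.mp hi))), h0, degree_zero,
          WithBot.bot_add]
      rw [hC, hrec, hz _ (by simp), Finset.sum_eq_zero fun i hi => by rw [hz i hi, zero_mul], h0]
      simp
    · rw [degree_eq_natDegree h0] at ih hj ⊢
      rw [hC, hrec, degree_sub_eq_left_of_degree_lt, degree_mul, degree_X, hj]
      · push_cast; ring
      · rw [degree_mul, degree_X, hj]
        refine (degree_sum_le _ _).trans_lt
          ((Finset.sup_lt_iff (by exact_mod_cast WithBot.bot_lt_coe _)).mpr fun i hi => ?_)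
        have hik : (i : ℕ) ≤ k := Fin.le_def.mp (Finset.mem_Iic.mp hi)
        refine (degree_mul_le _ _).trans_lt ?_
        rw [ih i (by omega)]
        refine (add_le_add_right degree_C_le _).trans_lt ?_
        rw [add_zero]
        exact_mod_cast (by omega : (a 0).natDegree + (i : ℕ) < (a 0).natDegree + k + 1)

/-- A Hessenberg matrix with nonzero subdiagonal entries is uniquely
determined by its first n−1 columns (its Hessenberg type) and its characteristic
polynomial. -/
theorem statement3 (n : ℕ) (hn : 1 ≤ n) (M M' : Matrix (Fin n) (Fin n) ℤ)
    (hM : IsHessenberg M) (hM' : IsHessenberg M')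
    (hsub : ∀ j : ℕ, j + 1 < n → subdiag M j ≠ 0)
    (hsub' : ∀ j : ℕ, j + 1 < n → subdiag M' j ≠ 0)
    (hcols : ∀ i j : Fin n, (j : ℕ) + 1 < n → M i j = M' i j)
    (hchar : M.charpoly = M'.charpoly) :
    M = M' := by
  obtain ⟨m, rfl⟩ : ∃ m, n = m + 1 := ⟨n - 1, by omega⟩
  have hcol (i) (j : Fin m) : M i j.castSucc = M' i j.castSucc := hcols _ _ (by simp)
  have hs (j : Fin m) : M j.succ j.castSucc ≠ 0 := by
    have := hsub j (by simp)
    rwa [subdiag, dif_pos (by simp)] at this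
  set a := M.charmatrix.adjugate (Fin.last m) with ha
  have ha' : a = M'.charmatrix.adjugate (Fin.last m) :=
    Matrix.adjugate_last_eq_of_forall_castSucc fun i j => by
      simp only [Matrix.charmatrix_apply, hcol]
  have hdeg := hM.degree_eq_of_sum_mul_charmatrix_eq_zero hs (a := a) fun j => by
    rw [ha, Matrix.sum_adjugate_mul, if_neg j.castSucc_lt_last.ne']
  have hlast : ∑ i, a i * M.charmatrix i (Fin.last m) = M.charpoly := by
    rw [ha, Matrix.sum_adjugate_mul, if_pos rfl, Matrix.charpoly]
  have hlast' : ∑ i, a i * M'.charmatrix i (Fin.last m) = M'.charpoly := by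
    rw [ha', Matrix.sum_adjugate_mul, if_pos rfl, Matrix.charpoly]
  have ha0 : a 0 ≠ 0 := fun h0 => by
    have hz (i) : a i = 0 := by
      rw [← degree_eq_bot, hdeg, h0, degree_zero, WithBot.bot_add]
    exact M.charpoly_monic.ne_zero (by simp [← hlast, hz])
  have hdeg' (i) : (a i).degree = ((a 0).natDegree + (i : ℕ) : ℕ) := by
    rw [hdeg, degree_eq_natDegree ha0, Nat.cast_add]
  have hd := eq_zero_of_sum_mul_C_eq_zero (a := a)
    (d := fun i => M i (Fin.last m) - M' i (Fin.last m))
    (fun i h0 => WithBot.bot_ne_coe (degree_zero.symm.trans (h0 ▸ hdeg' i)))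
    (fun i j hij => by
      simp only [hdeg', Nat.cast_inj] at hij
      exact Fin.ext (by omega))
    (by
      rw [← sub_eq_zero.mpr hchar.symm, ← hlast, ← hlast', ← Finset.sum_sub_distrib]
      refine Finset.sum_congr rfl fun i _ => ?_
      simp only [Matrix.charmatrix_apply, map_sub]
      ring)
  ext i j
  induction j using Fin.lastCases with
  | last => exact sub_eq_zero.mp (hd i)
  | cast j => exact hcol i j
end

section
/- Let n ≥ 2 and let M ∈ SL(n,ℤ) have characteristic polynomial irreducible over ℚ. Then the set of reduced perfect Hessenberg matrices that are integer conjugate to M is nonempty and finite. -/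
open Matrix Polynomial

namespace HessenbergReduction

variable {n : ℕ}

/-! ### Integer conjugacy -/

theorem integerConjugate_refl (A : Matrix (Fin n) (Fin n) ℤ) : IntegerConjugate A A :=
  ⟨1, by simp, by simp⟩

theorem integerConjugate_trans {A B C : Matrix (Fin n) (Fin n) ℤ}
    (hAB : IntegerConjugate A B) (hBC : IntegerConjugate B C) : IntegerConjugate A C := by
  obtain ⟨X, hX, hXA⟩ := hAB
  obtain ⟨Y, hY, hYB⟩ := hBC
  refine ⟨Y * X, by rw [det_mul]; exact hY.mul hX, ?_⟩
  rw [Matrix.mul_assoc, hXA, ← Matrix.mul_assoc, hYB, Matrix.mul_assoc]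

theorem integerConjugate_conj (A X : Matrix (Fin n) (Fin n) ℤ) (hX : IsUnit X.det) :
    IntegerConjugate A (X * A * X⁻¹) :=
  ⟨X, hX, by rw [Matrix.mul_assoc, nonsing_inv_mul _ hX, Matrix.mul_one]⟩

theorem integerConjugate_symm {A B : Matrix (Fin n) (Fin n) ℤ}
    (h : IntegerConjugate A B) : IntegerConjugate B A := by
  obtain ⟨X, hX, hXA⟩ := h
  refine ⟨X⁻¹, isUnit_nonsing_inv_det X hX, ?_⟩
  calc X⁻¹ * B = X⁻¹ * (B * X) * X⁻¹ := by
        rw [Matrix.mul_assoc, Matrix.mul_assoc, mul_nonsing_inv _ hX, Matrix.mul_one]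
    _ = A * X⁻¹ := by rw [← hXA, ← Matrix.mul_assoc, nonsing_inv_mul _ hX, Matrix.one_mul]

theorem IntegerConjugate.charpoly_eq {A B : Matrix (Fin n) (Fin n) ℤ}
    (h : IntegerConjugate A B) : B.charpoly = A.charpoly := by
  obtain ⟨X, hX, hXA⟩ := h
  have hB : B = X * (A * X⁻¹) := by
    rw [← Matrix.mul_assoc, hXA, Matrix.mul_assoc, mul_nonsing_inv _ hX, Matrix.mul_one]
  rw [hB, charpoly_mul_comm, Matrix.mul_assoc, nonsing_inv_mul _ hX, Matrix.mul_one]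

theorem IntegerConjugate.det_eq {A B : Matrix (Fin n) (Fin n) ℤ}
    (h : IntegerConjugate A B) : B.det = A.det := by
  rw [det_eq_sign_charpoly_coeff, det_eq_sign_charpoly_coeff, IntegerConjugate.charpoly_eq h]

/-! ### Irreducibility excludes invariant coordinate subspaces -/

theorem exists_ne_zero_of_irreducible_charpoly (A : Matrix (Fin n) (Fin n) ℤ)
    (hirr : Irreducible ((A.charpoly).map (Int.castRingHom ℚ)))
    (p : Fin n → Prop) [DecidablePred p] (hp : ∃ j, p j) (hnp : ∃ i, ¬ p i) :
    ∃ i j, ¬ p i ∧ p j ∧ A i j ≠ 0 := by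
  by_contra! h
  have block_charpoly (q : Fin n → Prop) [DecidablePred q] :
      (A.charmatrix.toSquareBlockProp q).det = (A.toSquareBlockProp q).charpoly := by
    rw [Matrix.charpoly]
    congr 1
    ext i j : 1
    simp [charmatrix_apply, toSquareBlockProp_def, diagonal_apply, Subtype.ext_iff]
  have hfac : A.charpoly = (A.toSquareBlockProp p).charpoly *
      (A.toSquareBlockProp fun i => ¬ p i).charpoly := by
    rw [← block_charpoly, ← block_charpoly]
    refine twoBlockTriangular_det _ _ fun i hi j hj => ?_
    have hij : i ≠ j := by rintro rfl; exact hi hj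
    simp [hij, h i j hi hj]
  have not_unit (q : Fin n → Prop) [DecidablePred q] (hq : ∃ j, q j) :
      ¬ IsUnit (((A.toSquareBlockProp q).charpoly).map (Int.castRingHom ℚ)) := by
    intro hu
    have hm := (A.toSquareBlockProp q).charpoly_monic
    have h0 := natDegree_eq_zero_of_isUnit hu
    rw [hm.natDegree_map, charpoly_natDegree_eq_dim, Fintype.card_eq_zero_iff] at h0
    obtain ⟨j, hj⟩ := hq
    exact h0.false ⟨j, hj⟩
  rw [hfac, Polynomial.map_mul] at hirr
  rcases hirr.isUnit_or_isUnit rfl with hu | hu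
  · exact not_unit p hp hu
  · exact not_unit _ hnp hu

/-! ### Unimodular matrices fixing the first coordinate vectors -/

/-- Unimodular matrices fixing the coordinate vectors with index below `k`. -/
def FixesBelow (k : Fin n) (X : Matrix (Fin n) (Fin n) ℤ) : Prop :=
  IsUnit X.det ∧ ∀ j < k, X *ᵥ Pi.single j 1 = Pi.single j 1

theorem FixesBelow.mul {k : Fin n} {X Y : Matrix (Fin n) (Fin n) ℤ}
    (hX : FixesBelow k X) (hY : FixesBelow k Y) : FixesBelow k (X * Y) :=
  ⟨by rw [det_mul]; exact hX.1.mul hY.1,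
    fun j hj => by rw [← mulVec_mulVec, hY.2 j hj, hX.2 j hj]⟩

theorem FixesBelow.mulVec_eq {k : Fin n} {X : Matrix (Fin n) (Fin n) ℤ}
    (hX : FixesBelow k X) {v : Fin n → ℤ} (hv : ∀ i, k ≤ i → v i = 0) : X *ᵥ v = v := by
  have hcol : ∀ j < k, ∀ i, X i j = (1 : Matrix (Fin n) (Fin n) ℤ) i j := fun j hj i => by
    have := congrFun (hX.2 j hj) i
    rw [mulVec_single_one] at this
    simpa [Matrix.one_apply, Pi.single_apply] using this
  calc X *ᵥ v = (1 : Matrix (Fin n) (Fin n) ℤ) *ᵥ v := by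
        ext i
        simp only [mulVec, dotProduct]
        refine Finset.sum_congr rfl fun j _ => ?_
        rcases lt_or_ge j k with hj | hj
        · rw [hcol j hj]
        · rw [hv j hj, mul_zero, mul_zero]
    _ = v := one_mulVec v

theorem updateCol_one_mulVec_apply (k : Fin n) (v x : Fin n → ℤ) (i : Fin n) :
    ((1 : Matrix (Fin n) (Fin n) ℤ).updateCol k v *ᵥ x) i =
      (if i = k then 0 else x i) + v i * x k := by
  rw [mulVec, dotProduct, ← Finset.add_sum_erase _ _ (Finset.mem_univ k), add_comm]
  congr 1
  · rw [Finset.sum_congr rfl (g := fun j => if i = j then x j else 0)]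
    · rw [Finset.sum_ite_eq]
      simp
    · intro j hj
      rw [updateCol_ne (Finset.ne_of_mem_erase hj), Matrix.one_apply]
      split_ifs <;> simp
  · rw [updateCol_self]

theorem fixesBelow_updateCol_one {k l : Fin n} (hkl : k ≤ l) {v : Fin n → ℤ}
    (hv : IsUnit (v l)) : FixesBelow k ((1 : Matrix (Fin n) (Fin n) ℤ).updateCol l v) := by
  refine ⟨?_, fun j hj => ?_⟩
  · have h : (cramer (1 : Matrix (Fin n) (Fin n) ℤ) v) l = v l := by rw [cramer_one]; rfl
    rw [cramer_apply] at h
    rwa [h]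
  · have hjl : j ≠ l := (hj.trans_le hkl).ne
    ext i
    rw [updateCol_one_mulVec_apply, Pi.single_eq_of_ne hjl.symm]
    split_ifs with h
    · rw [h, Pi.single_eq_of_ne hjl.symm]; simp
    · simp

/-- Adding a multiple of one coordinate to another. -/
theorem exists_fixesBelow_add {k i l : Fin n} (hkl : k ≤ l) (hil : i ≠ l) (a : ℤ)
    (x : Fin n → ℤ) : ∃ X, FixesBelow k X ∧ (X *ᵥ x) i = x i + a * x l ∧
      ∀ j ≠ i, (X *ᵥ x) j = x j := by
  refine ⟨_, fixesBelow_updateCol_one hkl (v := Pi.single l 1 + Pi.single i a) ?_, ?_, ?_⟩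
  · simp [hil.symm]
  · rw [updateCol_one_mulVec_apply]
    simp [hil]
  · intro j hj
    rw [updateCol_one_mulVec_apply]
    by_cases h : j = l
    · subst h; simp [hj]
    · simp [h, hj]

theorem exists_fixesBelow_pos (k : Fin n) (c : Fin n → ℤ) (hc : ∃ j, k ≤ j ∧ c j ≠ 0) :
    ∃ X, FixesBelow k X ∧ 0 < (X *ᵥ c) k := by
  have hne : ∃ X, FixesBelow k X ∧ (X *ᵥ c) k ≠ 0 := by
    by_cases hk : c k = 0
    · obtain ⟨j, hkj, hj⟩ := hc
      have hkj' : k ≠ j := by rintro rfl; exact hj hk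
      obtain ⟨X, hX, hXk, -⟩ := exists_fixesBelow_add hkj hkj' 1 c
      exact ⟨X, hX, by rw [hXk, hk]; simpa using hj⟩
    · exact ⟨1, ⟨by simp, fun j _ => one_mulVec _⟩, by rwa [one_mulVec]⟩
  obtain ⟨X, hX, hXk⟩ := hne
  rcases hXk.lt_or_gt with h | h
  · refine ⟨_, (fixesBelow_updateCol_one le_rfl (v := Pi.single k (-1)) ?_).mul hX, ?_⟩
    · simp
    · rw [← mulVec_mulVec, updateCol_one_mulVec_apply]
      simpa using h
  · exact ⟨X, hX, h⟩

/-- Hermite-type reduction of a single integer vector, with pivot at position `k`. -/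
theorem exists_fixesBelow_reduced (k : Fin n) (c : Fin n → ℤ) (hc : ∃ j, k ≤ j ∧ c j ≠ 0) :
    ∃ X, FixesBelow k X ∧ 0 < (X *ᵥ c) k ∧ (∀ i, k < i → (X *ᵥ c) i = 0) ∧
      ∀ i < k, 0 ≤ (X *ᵥ c) i ∧ (X *ᵥ c) i < (X *ᵥ c) k := by
  classical
  have hex : ∃ m : ℕ, ∃ X, FixesBelow k X ∧ 0 < (X *ᵥ c) k ∧ ((X *ᵥ c) k).toNat = m := by
    obtain ⟨X, hX, h⟩ := exists_fixesBelow_pos k c hc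
    exact ⟨_, X, hX, h, rfl⟩
  obtain ⟨X, hX, hpos, hm⟩ := Nat.find_spec hex
  have hmin : ∀ Y, FixesBelow k Y → 0 < (Y *ᵥ c) k → (X *ᵥ c) k ≤ (Y *ᵥ c) k := by
    intro Y hY hYpos
    have := Nat.find_min' hex ⟨Y, hY, hYpos, rfl⟩
    omega
  set x := X *ᵥ c with hx
  have hdvd : ∀ i, k < i → x i % x k = 0 := by
    intro i hi
    by_contra hr
    have h1 := Int.emod_nonneg (x i) hpos.ne'
    have h2 := Int.emod_lt_of_pos (x i) hpos
    obtain ⟨Y, hY, hYi, hYo⟩ := exists_fixesBelow_add le_rfl hi.ne' (-(x i / x k)) x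
    obtain ⟨Z, hZ, hZk, -⟩ := exists_fixesBelow_add hi.le hi.ne (-1) (Y *ᵥ x)
    have hval : (Z *ᵥ (Y *ᵥ x)) k = x k - x i % x k := by
      rw [hZk, hYi, hYo k hi.ne, Int.emod_def]; ring
    have := hmin (Z * (Y * X)) (hZ.mul (hY.mul hX))
    rw [← mulVec_mulVec, ← mulVec_mulVec, ← hx, hval] at this
    have := this (by omega)
    omega
  have hval : ∀ i, ((1 : Matrix (Fin n) (Fin n) ℤ).updateCol k
      (fun i => if i = k then 1 else -(x i / x k)) *ᵥ x) i =
        if i = k then x k else x i % x k := by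
    intro i
    rw [updateCol_one_mulVec_apply]
    split_ifs with h
    · ring
    · rw [Int.emod_def]; ring
  refine ⟨_, (fixesBelow_updateCol_one le_rfl
    (v := fun i => if i = k then 1 else -(x i / x k)) (by simp)).mul hX, ?_⟩
  rw [← mulVec_mulVec, ← hx]
  simp only [hval, if_true]
  refine ⟨hpos, fun i hi => ?_, fun i hi => ?_⟩
  · rw [if_neg hi.ne', hdvd i hi]
  · rw [if_neg hi.ne]
    exact ⟨Int.emod_nonneg _ hpos.ne', Int.emod_lt_of_pos _ hpos⟩

/-! ### Existence of perfect Hessenberg matrices -/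

theorem subdiag_eq (A : Matrix (Fin n) (Fin n) ℤ) (j : Fin n) (h : (j : ℕ) + 1 < n) :
    subdiag A j = A ⟨j + 1, h⟩ j := by
  simp [subdiag, h]

/-- The column `j` satisfies the Hessenberg condition and the perfectness inequalities. -/
def IsPerfectCol (A : Matrix (Fin n) (Fin n) ℤ) (j : Fin n) : Prop :=
  (∀ i : Fin n, (j : ℕ) + 1 < i → A i j = 0) ∧
    ∀ i, i ≤ j → 0 ≤ A i j ∧ A i j < subdiag A j

theorem exists_perfectCols (A : Matrix (Fin n) (Fin n) ℤ)
    (hirr : Irreducible ((A.charpoly).map (Int.castRingHom ℚ))) (k : ℕ) (hk : k < n) :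
    ∃ H, IntegerConjugate A H ∧ ∀ j : Fin n, (j : ℕ) < k → IsPerfectCol H j := by
  induction k with
  | zero => exact ⟨A, integerConjugate_refl A, fun j hj => absurd hj (Nat.not_lt_zero _)⟩
  | succ k ih =>
    obtain ⟨H, hAH, hH⟩ := ih (by omega)
    let q : Fin n := ⟨k, by omega⟩
    let r : Fin n := ⟨k + 1, hk⟩
    have hc : ∃ i, r ≤ i ∧ (H.col q) i ≠ 0 := by
      rw [← IntegerConjugate.charpoly_eq hAH] at hirr
      obtain ⟨i, j, hi, hj, hij⟩ := exists_ne_zero_of_irreducible_charpoly H hirr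
        (fun i => i ≤ q) ⟨q, le_rfl⟩ ⟨r, by simp [q, r]⟩
      have hi' : k < i := by simpa [q, Fin.lt_def] using hi
      have hj' : (j : ℕ) ≤ k := by simpa [q, Fin.le_def] using hj
      rcases hj'.lt_or_eq with h | h
      · exact absurd ((hH j h).1 i (by omega)) hij
      · obtain rfl : j = q := Fin.ext h
        exact ⟨i, hi', hij⟩
    obtain ⟨X, hX, hpos, hzero, hred⟩ := exists_fixesBelow_reduced r _ hc
    refine ⟨X * H * X⁻¹, integerConjugate_trans hAH (integerConjugate_conj H X hX.1), ?_⟩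
    have hcol : ∀ j < r, (X * H * X⁻¹).col j = X *ᵥ H.col j := by
      intro j hj
      rw [← mulVec_single_one, ← mulVec_single_one]
      conv_lhs => rw [← hX.2 j hj]
      rw [mulVec_mulVec, mulVec_mulVec, Matrix.mul_assoc _ X⁻¹, nonsing_inv_mul _ hX.1,
        Matrix.mul_one]
    intro j hj
    have hjr : j < r := hj
    have hjn : (j : ℕ) + 1 < n := by omega
    have happ : ∀ i, (X * H * X⁻¹) i j = (X *ᵥ H.col j) i := fun i => congrFun (hcol j hjr) i
    rcases (Nat.lt_succ_iff.1 hj).lt_or_eq with h | h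
    · have hfix : X *ᵥ H.col j = H.col j :=
        hX.mulVec_eq fun i hi => (hH j h).1 i (by
          have : k + 1 ≤ (i : ℕ) := hi
          omega)
      have happ' : ∀ i, (X * H * X⁻¹) i j = H i j := fun i => by rw [happ, hfix]; rfl
      refine ⟨fun i hi => ?_, fun i hi => ?_⟩
      · rw [happ', (hH j h).1 i hi]
      · rw [subdiag_eq _ _ hjn, happ', happ', ← subdiag_eq H j hjn]
        exact (hH j h).2 i hi
    · obtain rfl : j = q := Fin.ext h
      refine ⟨fun i hi => ?_, fun i hi => ?_⟩
      · rw [happ]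
        exact hzero i hi
      · rw [subdiag_eq _ _ hjn, happ, happ]
        exact hred i (lt_of_le_of_lt hi hjr)

theorem exists_isPerfect (A : Matrix (Fin n) (Fin n) ℤ) (hn : 0 < n) (hdet : A.det = 1)
    (hirr : Irreducible ((A.charpoly).map (Int.castRingHom ℚ))) :
    ∃ H, IsPerfect H ∧ IntegerConjugate A H := by
  obtain ⟨H, hAH, hH⟩ := exists_perfectCols A hirr (n - 1) (by omega)
  refine ⟨H, ⟨by rw [IntegerConjugate.det_eq hAH, hdet], fun i j hij => ?_,
    by rwa [IntegerConjugate.charpoly_eq hAH], fun i j hij hj => ?_⟩, hAH⟩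
  · exact (hH j (by have := i.isLt; omega)).1 i hij
  · exact (hH j (by omega)).2 i hij

theorem hessComplexity_nonneg (A : Matrix (Fin n) (Fin n) ℤ) : 0 ≤ hessComplexity A :=
  Finset.prod_nonneg fun _ _ => pow_nonneg (abs_nonneg _) _

theorem exists_isReducedHess (A : Matrix (Fin n) (Fin n) ℤ) (hn : 0 < n) (hdet : A.det = 1)
    (hirr : Irreducible ((A.charpoly).map (Int.castRingHom ℚ))) :
    ∃ H, IsReducedHess H ∧ IntegerConjugate A H := by
  classical
  have hex : ∃ m : ℕ, ∃ H, (IsPerfect H ∧ IntegerConjugate A H) ∧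
      (hessComplexity H).toNat = m := by
    obtain ⟨H, hH⟩ := exists_isPerfect A hn hdet hirr
    exact ⟨_, H, hH, rfl⟩
  obtain ⟨H, ⟨hP, hAH⟩, hm⟩ := Nat.find_spec hex
  refine ⟨H, ⟨hP, fun B hB hHB => ?_⟩, hAH⟩
  have := Nat.find_min' hex ⟨B, ⟨hB, integerConjugate_trans hAH hHB⟩, rfl⟩
  have := hessComplexity_nonneg B
  omega

/-! ### Finiteness -/

theorem IsPerfect.subdiag_pos {H : Matrix (Fin n) (Fin n) ℤ} (hH : IsPerfect H) {j : ℕ}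
    (hj : j + 1 < n) : 0 < subdiag H j := by
  have := hH.2.2.2 ⟨j, by omega⟩ ⟨j, by omega⟩ le_rfl hj
  exact this.1.trans_lt this.2

theorem IsPerfect.subdiag_le {H : Matrix (Fin n) (Fin n) ℤ} (hH : IsPerfect H) {j : ℕ}
    (hj : j + 1 < n) : subdiag H j ≤ hessComplexity H := by
  have hpos : 0 < hessComplexity H := by
    refine Finset.prod_pos fun i hi => pow_pos (abs_pos.2 ?_) _
    exact (IsPerfect.subdiag_pos hH (by rw [Finset.mem_range] at hi; omega)).ne'
  refine Int.le_of_dvd hpos (((dvd_abs _ _).2 dvd_rfl).trans ?_)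
  refine (dvd_pow_self _ (by omega : n - 1 - j ≠ 0)).trans ?_
  exact Finset.dvd_prod_of_mem (fun j => |subdiag H j| ^ (n - 1 - j))
    (Finset.mem_range.2 (by omega))

theorem IsPerfect.mem_Icc {H : Matrix (Fin n) (Fin n) ℤ} (hH : IsPerfect H) (i j : Fin n)
    (hj : (j : ℕ) + 1 < n) : H i j ∈ Set.Icc 0 (hessComplexity H) := by
  have hle := IsPerfect.subdiag_le hH hj
  have hpos := IsPerfect.subdiag_pos hH hj
  rcases lt_trichotomy (i : ℕ) (j + 1) with h | h | h
  · have := hH.2.2.2 i j (by rw [Fin.le_def]; omega) hj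
    exact ⟨this.1, this.2.le.trans hle⟩
  · obtain rfl : i = ⟨j + 1, hj⟩ := Fin.ext h
    rw [← subdiag_eq H j hj]
    exact ⟨hpos.le, hle⟩
  · rw [hH.2.1 i j h]
    exact ⟨le_rfl, hpos.le.trans hle⟩

/-- The first coordinate vector is cyclic: its Krylov sequence is in echelon form, and only
depends on the columns other than the last. -/
theorem krylov_echelon {A B : Matrix (Fin n) (Fin n) ℤ} (hn : 0 < n) (hA : IsHessenberg A)
    (hsub : ∀ j, j + 1 < n → subdiag A j ≠ 0)
    (hAB : ∀ i j : Fin n, (j : ℕ) + 1 < n → A i j = B i j) (k : ℕ) (hk : k < n) :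
    B ^ k *ᵥ Pi.single ⟨0, hn⟩ 1 = A ^ k *ᵥ Pi.single ⟨0, hn⟩ 1 ∧
    (∀ i : Fin n, k < i → (A ^ k *ᵥ Pi.single ⟨0, hn⟩ 1) i = 0) ∧
    (A ^ k *ᵥ Pi.single ⟨0, hn⟩ 1) ⟨k, hk⟩ ≠ 0 := by
  induction k with
  | zero =>
    refine ⟨by simp, fun i hi => ?_, by simp⟩
    have : i ≠ ⟨0, hn⟩ := by rintro rfl; exact lt_irrefl _ hi
    simp [this]
  | succ k ih =>
    obtain ⟨h1, h2, h3⟩ := ih (by omega)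
    rw [pow_succ', pow_succ', ← mulVec_mulVec, ← mulVec_mulVec, h1]
    generalize A ^ k *ᵥ Pi.single ⟨0, hn⟩ 1 = v at h2 h3
    refine ⟨?_, fun i hi => ?_, ?_⟩
    · ext i
      simp only [mulVec, dotProduct]
      refine Finset.sum_congr rfl fun j _ => ?_
      by_cases hj : (j : ℕ) + 1 < n
      · rw [hAB i j hj]
      · rw [h2 j (by omega), mul_zero, mul_zero]
    · simp only [mulVec, dotProduct]
      refine Finset.sum_eq_zero fun j _ => ?_
      rcases lt_or_ge k j with hj | hj
      · rw [h2 j hj, mul_zero]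
      · rw [hA i j (by omega), zero_mul]
    · have : (A *ᵥ v) ⟨k + 1, hk⟩ = A ⟨k + 1, hk⟩ ⟨k, by omega⟩ * v ⟨k, by omega⟩ := by
        simp only [mulVec, dotProduct]
        refine Finset.sum_eq_single (⟨k, by omega⟩ : Fin n) (fun j _ hj => ?_) (by simp)
        rcases lt_or_ge k j with h | h
        · rw [h2 j h, mul_zero]
        · have : (j : ℕ) ≠ k := fun h => hj (Fin.ext h)
          rw [hA _ j (by simp only; omega), zero_mul]
      rw [this, ← subdiag_eq A ⟨k, by omega⟩ hk]
      exact mul_ne_zero (hsub k hk) h3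

theorem pow_mulVec_eq_neg_sum (A : Matrix (Fin n) (Fin n) ℤ) (v : Fin n → ℤ) :
    A ^ n *ᵥ v = - ∑ i ∈ Finset.range n, A.charpoly.coeff i • (A ^ i *ᵥ v) := by
  have hdeg : A.charpoly.natDegree = n := by simp [charpoly_natDegree_eq_dim]
  have hlead : A.charpoly.coeff n = 1 := by
    simpa [hdeg] using A.charpoly_monic.coeff_natDegree
  have h := congrArg (· *ᵥ v) (aeval_self_charpoly A)
  simp only [aeval_eq_sum_range, hdeg, Finset.sum_range_succ, hlead, one_smul, add_mulVec,
    sum_mulVec, smul_mulVec, zero_mulVec] at h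
  exact eq_neg_of_add_eq_zero_right h

/-- A Hessenberg matrix with nonzero subdiagonal is determined by its characteristic polynomial
and all its columns but the last. -/
theorem eq_of_charpoly_eq {A B : Matrix (Fin n) (Fin n) ℤ} (hA : IsHessenberg A)
    (hsub : ∀ j, j + 1 < n → subdiag A j ≠ 0)
    (hAB : ∀ i j : Fin n, (j : ℕ) + 1 < n → A i j = B i j)
    (hchar : A.charpoly = B.charpoly) : A = B := by
  obtain _ | m := n
  · exact Subsingleton.elim _ _
  have hn : 0 < m + 1 := m.succ_pos
  obtain ⟨h1, -, h3⟩ := krylov_echelon hn hA hsub hAB m (Nat.lt_succ_self m)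
  have hpow : A ^ (m + 1) *ᵥ Pi.single ⟨0, hn⟩ 1 = B ^ (m + 1) *ᵥ Pi.single ⟨0, hn⟩ 1 := by
    rw [pow_mulVec_eq_neg_sum, pow_mulVec_eq_neg_sum, hchar]
    congr 1
    refine Finset.sum_congr rfl fun i hi => ?_
    rw [(krylov_echelon hn hA hsub hAB i (Finset.mem_range.1 hi)).1]
  rw [pow_succ', pow_succ', ← mulVec_mulVec, ← mulVec_mulVec, h1] at hpow
  ext i j
  by_cases hj : (j : ℕ) + 1 < m + 1
  · exact hAB i j hj
  · obtain rfl : j = ⟨m, Nat.lt_succ_self m⟩ := Fin.ext (by have := j.isLt; simp only; omega)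
    have h := congrFun hpow i
    rw [mulVec, mulVec, dotProduct, dotProduct,
      ← Finset.add_sum_erase _ _ (Finset.mem_univ (⟨m, Nat.lt_succ_self m⟩ : Fin (m + 1))),
      ← Finset.add_sum_erase _ _ (Finset.mem_univ (⟨m, Nat.lt_succ_self m⟩ : Fin (m + 1))),
      Finset.sum_congr rfl (g := fun j => B i j * _)] at h
    · exact mul_right_cancel₀ h3 (add_right_cancel h)
    · intro j hj
      have : (j : ℕ) ≠ m := fun h => Finset.ne_of_mem_erase hj (Fin.ext h)
      rw [hAB i j (by have := j.isLt; omega)]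

theorem finite_isPerfect (p : ℤ[X]) (c : ℤ) :
    {H : Matrix (Fin n) (Fin n) ℤ |
      IsPerfect H ∧ H.charpoly = p ∧ hessComplexity H ≤ c}.Finite := by
  let f : Matrix (Fin n) (Fin n) ℤ → Fin n → Fin n → ℤ :=
    fun H i j => if (j : ℕ) + 1 < n then H i j else 0
  refine Set.Finite.of_finite_image (f := f) (Set.Finite.subset
    (Set.Finite.pi' fun _ => Set.Finite.pi' fun _ => Set.finite_Icc (0 : ℤ) c) ?_) ?_
  · rintro _ ⟨H, ⟨hP, -, hc⟩, rfl⟩ i j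
    simp only [f]
    split_ifs with hj
    · exact Set.Icc_subset_Icc_right hc (IsPerfect.mem_Icc hP i j hj)
    · exact ⟨le_rfl, (hessComplexity_nonneg H).trans hc⟩
  · rintro A ⟨hA, hAp, -⟩ B ⟨-, hBp, -⟩ hAB
    refine eq_of_charpoly_eq hA.2.1 (fun j hj => (IsPerfect.subdiag_pos hA hj).ne')
      (fun i j hj => ?_) (hAp.trans hBp.symm)
    simpa [f, hj] using congrFun (congrFun hAB i) j

end HessenbergReduction

open HessenbergReduction in
/-- For `M ∈ SL(n,ℤ)` (n ≥ 2) with characteristic polynomial irreducible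
over ℚ, the set of reduced perfect Hessenberg matrices integer conjugate to `M` is
nonempty and finite. -/
theorem statement4 (n : ℕ) (hn : 2 ≤ n) (M : Matrix (Fin n) (Fin n) ℤ)
    (hdet : M.det = 1)
    (hirr : Irreducible ((M.charpoly).map (Int.castRingHom ℚ))) :
    {H : Matrix (Fin n) (Fin n) ℤ | IsReducedHess H ∧ IntegerConjugate M H}.Nonempty ∧
    {H : Matrix (Fin n) (Fin n) ℤ | IsReducedHess H ∧ IntegerConjugate M H}.Finite := by
  obtain ⟨W, hW, hMW⟩ := exists_isReducedHess M (by omega) hdet hirr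
  refine ⟨⟨W, hW, hMW⟩, (finite_isPerfect M.charpoly (hessComplexity W)).subset ?_⟩
  rintro H ⟨hH, hMH⟩
  exact ⟨hH.1, IntegerConjugate.charpoly_eq hMH,
    hH.2 W hW.1 (integerConjugate_trans (integerConjugate_symm hMH) hMW)⟩
end

section
/- Let n ≥ 1 and let M ∈ SL(n,ℤ) be a Hessenberg matrix. Then |det[e₁, M e₁, M² e₁, …, M^{n−1} e₁]| = ∏_{j=1}^{n−1} |M (j+1) j|^{n−j} = ς(M), where e₁ is the first standard basis vector and the determinant is taken of the n×n matrix whose j-th column is M^{j−1} e₁. In other words, the Hessenberg complexity of M equals the Markoff–Davenport characteristic Δ(M|e₁). -/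
open Matrix Polynomial

theorem Finset.prod_range_prod_range_eq_prod_pow {R : Type*} [CommMonoid R] (a : ℕ → R) (m : ℕ) :
    ∏ k ∈ Finset.range (m + 1), ∏ j ∈ Finset.range k, a j =
      ∏ j ∈ Finset.range m, a j ^ (m - j) := by
  induction m with
  | zero => simp
  | succ m ih =>
    rw [Finset.prod_range_succ, ih, Finset.prod_range_succ (fun j => a j ^ (m + 1 - j)),
      Finset.prod_range_succ a, ← mul_assoc, ← Finset.prod_mul_distrib]
    congr 1
    · refine Finset.prod_congr rfl fun j hj => ?_
      rw [← pow_succ, Nat.sub_add_comm (Finset.mem_range.mp hj).le]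
    · simp

/-- The `k`-th Krylov vector `M ^ k e₁` of a Hessenberg matrix vanishes below position `k`, where
its entry is the product of the first `k` subdiagonal entries of `M`. -/
theorem IsHessenberg.pow_mulVec_single {n : ℕ} {M : Matrix (Fin n) (Fin n) ℤ}
    (hM : IsHessenberg M) {z : Fin n} (hz : (z : ℕ) = 0) (k : ℕ) :
    (∀ i : Fin n, k < i → (M ^ k *ᵥ Pi.single z 1) i = 0) ∧
      ∀ i : Fin n, (i : ℕ) = k →
        (M ^ k *ᵥ Pi.single z 1) i = ∏ j ∈ Finset.range k, subdiag M j := by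
  induction k with
  | zero =>
    refine ⟨fun i hi => ?_, fun i hi => ?_⟩
    · have : i ≠ z := by rintro rfl; omega
      simp [this]
    · obtain rfl : i = z := Fin.ext (hi.trans hz.symm)
      simp
  | succ k ih =>
    rw [pow_succ', ← Matrix.mulVec_mulVec]
    refine ⟨fun i hi => ?_, fun i hi => ?_⟩
    · change ∑ j, M i j * (M ^ k *ᵥ Pi.single z 1) j = 0
      refine Finset.sum_eq_zero fun j _ => ?_
      rcases lt_or_ge k (j : ℕ) with h | h
      · rw [ih.1 j h, mul_zero]
      · rw [hM i j (by omega), zero_mul]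
    · have hk : k + 1 < n := hi ▸ i.isLt
      change ∑ j, M i j * (M ^ k *ᵥ Pi.single z 1) j = _
      rw [Finset.sum_eq_single (⟨k, by omega⟩ : Fin n) (fun j _ hj => ?_) (by simp)]
      · obtain rfl : i = ⟨k + 1, hk⟩ := Fin.ext hi
        rw [ih.2 _ rfl, Finset.prod_range_succ, mul_comm, subdiag, dif_pos hk]
      · have hj' : (j : ℕ) ≠ k := fun h => hj (Fin.ext h)
        rcases lt_or_ge k (j : ℕ) with h | h
        · rw [ih.1 j h, mul_zero]
        · rw [hM i j (by omega), zero_mul]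

/-- For a Hessenberg matrix `M ∈ SL(n,ℤ)`, the Markoff–Davenport
characteristic `Δ(M|e₁) = |det[e₁, M e₁, …, M^{n-1} e₁]|` equals the Hessenberg
complexity `ς(M)`. -/
theorem statement6 (n : ℕ) (hn : 1 ≤ n) (M : Matrix (Fin n) (Fin n) ℤ)
    (hdet : M.det = 1) (hHess : IsHessenberg M) :
    |(Matrix.of fun i j : Fin n =>
        ((M ^ (j : ℕ)).mulVec (Pi.single (⟨0, by omega⟩ : Fin n) 1)) i).det| =
      hessComplexity M := by
  rw [Matrix.det_of_isUpperTriangular]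
  · have hdiag : ∀ i : Fin n, (Matrix.of fun i j : Fin n =>
        ((M ^ (j : ℕ)).mulVec (Pi.single (⟨0, by omega⟩ : Fin n) 1)) i) i i =
          ∏ j ∈ Finset.range (i : ℕ), subdiag M j := fun i =>
      (hHess.pow_mulVec_single rfl i).2 i rfl
    rw [Finset.prod_congr rfl fun i _ => hdiag i,
      Fin.prod_univ_eq_prod_range (fun k => ∏ j ∈ Finset.range k, subdiag M j)]
    obtain ⟨m, rfl⟩ := Nat.exists_eq_add_of_le' hn
    rw [Finset.prod_range_prod_range_eq_prod_pow, Finset.abs_prod, hessComplexity]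
    simp [abs_pow]
  · exact fun i j hij => (hHess.pow_mulVec_single rfl j).1 i hij
end

section
/- Let n ≥ 2 and let A ∈ SL(n,ℤ) have characteristic polynomial irreducible over ℚ, with exactly k real eigenvalues r₁,…,r_k and l pairs of complex-conjugate (non-real) eigenvalues, where k + 2l = n. Then there exist a basis g₁,…,gₙ of ℝⁿ and a real number α > 0 such that: A gᵢ = rᵢ gᵢ for each i = 1,…,k; for each j = 1,…,l the complex vector g_{k+2j−1} + i·g_{k+2j} ∈ ℂⁿ is an eigenvector of A for a non-real eigenvalue; and for every vector v = Σ_{i=1}^{k} xᵢ gᵢ + Σ_{j=1}^{l} (y_j g_{k+2j−1} + z_j g_{k+2j}) ∈ ℝⁿ one has |det[v, Av, A²v, …, A^{n−1}v]| = α · |x₁ x₂ ⋯ x_k| · ∏_{j=1}^{l} (y_j² + z_j²). In other words, the Markoff–Davenport characteristic of A is the absolute value of a form associated to A with a nonzero coefficient α. -/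
open Matrix Polynomial

section Eigenvectors

variable {K : Type*} [Field K] {m : Type*} [Fintype m] [DecidableEq m]

theorem Matrix.exists_mulVec_eq_smul_of_isRoot_charpoly (M : Matrix m m K) {μ : K}
    (h : M.charpoly.IsRoot μ) : ∃ v : m → K, v ≠ 0 ∧ M *ᵥ v = μ • v := by
  rw [IsRoot, eval_charpoly] at h
  obtain ⟨v, hv, hv'⟩ := exists_mulVec_eq_zero_iff.mpr h
  refine ⟨v, hv, ?_⟩
  rw [sub_mulVec, sub_eq_zero, scalar_apply, ← smul_one_eq_diagonal, smul_mulVec,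
    one_mulVec] at hv'
  exact hv'.symm

theorem Matrix.pow_mulVec_eq_smul (M : Matrix m m K) {μ : K} {v : m → K}
    (h : M *ᵥ v = μ • v) (t : ℕ) : (M ^ t) *ᵥ v = μ ^ t • v := by
  induction t with
  | zero => simp
  | succ t ih => rw [pow_succ, ← mulVec_mulVec, h, mulVec_smul, ih, smul_smul, pow_succ']

theorem Matrix.linearIndependent_of_mulVec_eq_smul {σ : Type*} (M : Matrix m m K)
    (μ : σ → K) (hμ : Function.Injective μ) (W : σ → m → K) (hW0 : ∀ s, W s ≠ 0)
    (hW : ∀ s, M *ᵥ W s = μ s • W s) : LinearIndependent K W :=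
  Module.End.eigenvectors_linearIndependent' (Matrix.toLin' M) μ hμ W fun s =>
    ⟨Module.End.mem_eigenspace_iff.mpr (by simpa using hW s), hW0 s⟩

/-- The Krylov matrix of a combination of eigenvectors is the product of the matrix of
eigenvectors, the diagonal matrix of coefficients and a Vandermonde matrix. -/
theorem Matrix.det_krylov_sum_smul {n : ℕ} {σ : Type*} [Fintype σ] (e : Fin n ≃ σ)
    (M : Matrix (Fin n) (Fin n) K) (μ : σ → K) (W : σ → Fin n → K)
    (hW : ∀ s, M *ᵥ W s = μ s • W s) (a : σ → K) :
    (Matrix.of fun s t : Fin n => ((M ^ (t : ℕ)) *ᵥ (∑ τ, a τ • W τ)) s).det =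
      (Matrix.of fun s t : Fin n => W (e t) s).det * (∏ τ, a τ) *
        (vandermonde (μ ∘ e)).det := by
  rw [← e.prod_comp, ← det_diagonal (d := fun t => a (e t)), ← det_mul, ← det_mul]
  congr 1
  ext s t
  rw [Matrix.of_apply, mulVec_sum, mul_apply, ← e.sum_comp, Finset.sum_apply]
  refine Finset.sum_congr rfl fun i _ => ?_
  simp only [mulVec_smul, pow_mulVec_eq_smul M (hW (e i)), mul_diagonal, vandermonde_apply,
    Pi.smul_apply, smul_eq_mul, of_apply, Function.comp_apply]
  ring

end Eigenvectors

section finPairsEquiv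

variable {n k l : ℕ} (hkl : k + 2 * l = n)

/-- `Fin (k + 2 * l)` as `k` single indices followed by `l` pairs of consecutive indices. -/
def finPairsEquiv : Fin k ⊕ Fin l × Fin 2 ≃ Fin n :=
  ((Equiv.refl _).sumCongr finProdFinEquiv).trans
    (finSumFinEquiv.trans (finCongr (by rw [mul_comm l, hkl])))

theorem finPairsEquiv_inl (i : Fin k) :
    finPairsEquiv hkl (.inl i) = ⟨i, by have := i.isLt; omega⟩ := by
  ext; simp [finPairsEquiv]

theorem finPairsEquiv_inr_zero (j : Fin l) :
    finPairsEquiv hkl (.inr (j, 0)) = ⟨k + 2 * j, by have := j.isLt; omega⟩ := by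
  ext; simp [finPairsEquiv]

theorem finPairsEquiv_inr_one (j : Fin l) :
    finPairsEquiv hkl (.inr (j, 1)) = ⟨k + 2 * j + 1, by have := j.isLt; omega⟩ := by
  ext; simp [finPairsEquiv]; ring

theorem sum_eq_sum_add_sum_pairs {M : Type*} [AddCommMonoid M] (f : Fin n → M) :
    ∑ t, f t = (∑ i : Fin k, f ⟨i, by have := i.isLt; omega⟩) +
      ∑ j : Fin l, (f ⟨k + 2 * j, by have := j.isLt; omega⟩ +
        f ⟨k + 2 * j + 1, by have := j.isLt; omega⟩) := by
  simp only [← (finPairsEquiv hkl).sum_comp f, Fintype.sum_sum_type, Fintype.sum_prod_type,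
    Fin.sum_univ_two, finPairsEquiv_inl, finPairsEquiv_inr_zero, finPairsEquiv_inr_one]

variable {m : Type*} (w : Fin k → m → ℝ) (u : Fin l → m → ℂ)

/-- The vectors `w i`, followed by the real and imaginary parts of the `u j`. -/
noncomputable def realFrame (t : Fin n) : m → ℝ :=
  Sum.elim w (fun p s => if p.2 = 0 then (u p.1 s).re else (u p.1 s).im)
    ((finPairsEquiv hkl).symm t)

theorem realFrame_left (i : Fin k) (h : (i : ℕ) < n) : realFrame hkl w u ⟨i, h⟩ = w i := by
  rw [realFrame, ← finPairsEquiv_inl hkl, Equiv.symm_apply_apply, Sum.elim_inl]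

theorem realFrame_re (j : Fin l) (h : k + 2 * (j : ℕ) < n) (s : m) :
    realFrame hkl w u ⟨k + 2 * j, h⟩ s = (u j s).re := by
  rw [realFrame, ← finPairsEquiv_inr_zero hkl, Equiv.symm_apply_apply, Sum.elim_inr, if_pos rfl]

theorem realFrame_im (j : Fin l) (h : k + 2 * (j : ℕ) + 1 < n) (s : m) :
    realFrame hkl w u ⟨k + 2 * j + 1, h⟩ s = (u j s).im := by
  rw [realFrame, ← finPairsEquiv_inr_one hkl, Equiv.symm_apply_apply, Sum.elim_inr,
    if_neg (by simp)]

end finPairsEquiv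

/-- Real coordinates `x`, `y`, `z` rewritten as coordinates with respect to eigenvectors
`w i`, `u j` and the conjugates of the `u j`. -/
noncomputable def complexCoord {k l : ℕ} (x : Fin k → ℝ) (y z : Fin l → ℝ) :
    Fin k ⊕ Fin l ⊕ Fin l → ℂ :=
  Sum.elim (fun i => (x i : ℂ)) (Sum.elim (fun j => (y j - Complex.I * z j) / 2)
    (fun j => (y j + Complex.I * z j) / 2))

theorem norm_prod_complexCoord {k l : ℕ} (x : Fin k → ℝ) (y z : Fin l → ℝ) :
    ‖∏ s, complexCoord x y z s‖ = |∏ i, x i| * (∏ j, (y j ^ 2 + z j ^ 2)) / 4 ^ l := by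
  have h (j : Fin l) : ((y j - Complex.I * z j) / 2) * ((y j + Complex.I * z j) / 2) =
      (((y j ^ 2 + z j ^ 2) / 4 : ℝ) : ℂ) := by
    push_cast
    linear_combination (-(z j : ℂ) ^ 2 / 4) * Complex.I_sq
  simp only [complexCoord, Fintype.prod_sum_type, Sum.elim_inl, Sum.elim_inr,
    ← Finset.prod_mul_distrib, h, norm_mul]
  rw [← Complex.ofReal_prod, ← Complex.ofReal_prod, Complex.norm_real, Complex.norm_real,
    Real.norm_eq_abs, Real.norm_of_nonneg (Finset.prod_nonneg fun j _ => by positivity),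
    Finset.prod_div_distrib, mul_div_assoc]
  simp

theorem sum_complexCoord_smul {k l : ℕ} {m : Type*} (w : Fin k → m → ℝ) (u : Fin l → m → ℂ)
    (x : Fin k → ℝ) (y z : Fin l → ℝ) (v : m → ℝ)
    (hv : ∀ s, v s = (∑ i, x i * w i s) + ∑ j, (y j * (u j s).re + z j * (u j s).im)) :
    ∑ τ, complexCoord x y z τ • (Sum.elim (fun i s => (w i s : ℂ))
      (Sum.elim u fun j s => (starRingEnd ℂ) (u j s)) : Fin k ⊕ Fin l ⊕ Fin l → m → ℂ) τ =
      fun s => (v s : ℂ) := by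
  ext s
  simp only [complexCoord, Fintype.sum_sum_type, Sum.elim_inl, Sum.elim_inr,
    Finset.sum_apply, Pi.smul_apply, smul_eq_mul, hv, Complex.ofReal_add,
    Complex.ofReal_sum, ← Finset.sum_add_distrib, Complex.ofReal_mul]
  congr 1
  refine Finset.sum_congr rfl fun j _ => ?_
  apply Complex.ext <;> simp <;> ring

theorem Polynomial.nodup_roots_map_of_irreducible_map_rat {p : ℤ[X]}
    (h : Irreducible (p.map (Int.castRingHom ℚ))) :
    (p.map (Int.castRingHom ℂ)).roots.Nodup := by
  have := nodup_roots (h.separable.map (f := algebraMap ℚ ℂ))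
  rwa [Polynomial.map_map, RingHom.ext_int ((algebraMap ℚ ℂ).comp (Int.castRingHom ℚ))
    (Int.castRingHom ℂ)] at this

/-- For `A ∈ SL(n,ℤ)` with irreducible characteristic polynomial having
exactly `k` real eigenvalues `r₁,…,r_k` and `l` pairs of complex-conjugate non-real
eigenvalues (`k + 2l = n`), there is a basis `g₁,…,gₙ` of ℝⁿ and `α > 0` such that
`A gᵢ = rᵢ gᵢ` for `i ≤ k`, each `g_{k+2j-1} + i g_{k+2j}` is a complex eigenvector for
a non-real eigenvalue, and the Markoff–Davenport characteristic of
`v = Σ xᵢ gᵢ + Σ (yⱼ g_{k+2j-1} + zⱼ g_{k+2j})` equals `α |x₁⋯x_k| ∏ (yⱼ² + zⱼ²)`. -/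
theorem statement7 (n k l : ℕ) (hn : 2 ≤ n) (hkl : k + 2 * l = n)
    (A : Matrix (Fin n) (Fin n) ℤ) (hdet : A.det = 1)
    (hirr : Irreducible ((A.charpoly).map (Int.castRingHom ℚ)))
    (r : Fin k → ℝ) (c : Fin l → ℂ) (him : ∀ j, (c j).im ≠ 0)
    (hroots : ((A.charpoly).map (Int.castRingHom ℂ)).roots =
      Multiset.map (fun i => ((r i : ℝ) : ℂ)) Finset.univ.val +
      Multiset.map c Finset.univ.val +
      Multiset.map (fun j => (starRingEnd ℂ) (c j)) Finset.univ.val) :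
    ∃ (g : Fin n → Fin n → ℝ) (α : ℝ), 0 < α ∧ LinearIndependent ℝ g ∧
      (∀ i : Fin k,
        (A.map (Int.cast : ℤ → ℝ)).mulVec (g ⟨(i : ℕ), by have := i.isLt; omega⟩) =
          r i • g ⟨(i : ℕ), by have := i.isLt; omega⟩) ∧
      (∀ j : Fin l, ∃ μ : ℂ, μ.im ≠ 0 ∧
        (A.map (Int.cast : ℤ → ℂ)).mulVec
          (fun t : Fin n =>
            ((g ⟨k + 2 * (j : ℕ), by have := j.isLt; omega⟩ t : ℝ) : ℂ) +
              Complex.I * ((g ⟨k + 2 * (j : ℕ) + 1, by have := j.isLt; omega⟩ t : ℝ) : ℂ)) =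
        μ • fun t : Fin n =>
            ((g ⟨k + 2 * (j : ℕ), by have := j.isLt; omega⟩ t : ℝ) : ℂ) +
              Complex.I * ((g ⟨k + 2 * (j : ℕ) + 1, by have := j.isLt; omega⟩ t : ℝ) : ℂ)) ∧
      (∀ (x : Fin k → ℝ) (y z : Fin l → ℝ),
        |(Matrix.of fun s t : Fin n =>
            (((A.map (Int.cast : ℤ → ℝ)) ^ (t : ℕ)).mulVec
              ((∑ i : Fin k, x i • g ⟨(i : ℕ), by have := i.isLt; omega⟩) +
               (∑ j : Fin l,
                 (y j • g ⟨k + 2 * (j : ℕ), by have := j.isLt; omega⟩ +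
                  z j • g ⟨k + 2 * (j : ℕ) + 1, by have := j.isLt; omega⟩)))) s).det| =
          α * |∏ i : Fin k, x i| * ∏ j : Fin l, ((y j) ^ 2 + (z j) ^ 2)) := by
  set μ : Fin k ⊕ Fin l ⊕ Fin l → ℂ := Sum.elim (fun i => (r i : ℂ))
    (Sum.elim c fun j => (starRingEnd ℂ) (c j)) with hμ_def
  have hμ_roots : ((A.charpoly).map (Int.castRingHom ℂ)).roots =
      Multiset.map μ Finset.univ.val := by
    rw [hroots, ← Finset.univ_disjSum_univ, ← Finset.univ_disjSum_univ]
    simp [Finset.disjSum, Multiset.disjSum, hμ_def, Function.comp_def]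
  have hμ : Function.Injective μ := by
    have := nodup_roots_map_of_irreducible_map_rat hirr
    rw [hμ_roots] at this
    exact fun a b hab => Multiset.inj_on_of_nodup_map this a (Finset.mem_univ a) b
      (Finset.mem_univ b) hab
  have hroot (s) : ((A.charpoly).map (Int.castRingHom ℂ)).IsRoot (μ s) := by
    refine isRoot_of_mem_roots ?_
    rw [hμ_roots]
    exact Multiset.mem_map_of_mem _ (Finset.mem_univ s)
  have hu (j : Fin l) : ∃ v : Fin n → ℂ, v ≠ 0 ∧
      (A.map (Int.cast : ℤ → ℂ)) *ᵥ v = c j • v := by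
    refine exists_mulVec_eq_smul_of_isRoot_charpoly _ ?_
    have := hroot (.inr (.inl j))
    rwa [← charpoly_map] at this
  have hw (i : Fin k) : ∃ v : Fin n → ℝ, v ≠ 0 ∧
      (A.map (Int.cast : ℤ → ℝ)) *ᵥ v = r i • v := by
    refine exists_mulVec_eq_smul_of_isRoot_charpoly _ ?_
    have := hroot (.inl i)
    rw [← RingHom.ext_int (Complex.ofRealHom.comp (Int.castRingHom ℝ)) (Int.castRingHom ℂ),
      ← Polynomial.map_map] at this
    have := IsRoot.of_map (f := Complex.ofRealHom) (x := r i) this Complex.ofRealHom.injective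
    rwa [← charpoly_map] at this
  choose u hu0 hu using hu
  choose w hw0 hw using hw
  have hcast : (A.map (Int.cast : ℤ → ℂ)) = (A.map (Int.cast : ℤ → ℝ)).map Complex.ofRealHom := by
    ext; simp
  have hconj : (A.map (Int.cast : ℤ → ℂ)) =
      (A.map (Int.cast : ℤ → ℂ)).map (starRingEnd ℂ) := by
    ext; simp
  set W : Fin k ⊕ Fin l ⊕ Fin l → Fin n → ℂ := Sum.elim (fun i s => (w i s : ℂ))
      (Sum.elim u fun j s => (starRingEnd ℂ) (u j s)) with hW_def
  have hW0 (s) : W s ≠ 0 := by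
    rcases s with i | j | j
    · exact fun h => hw0 i (funext fun s => by simpa [hW_def] using congrFun h s)
    · exact hu0 j
    · exact fun h => hu0 j (funext fun s => by simpa [hW_def] using congrFun h s)
  have hW (s) : (A.map (Int.cast : ℤ → ℂ)) *ᵥ W s = μ s • W s := by
    rcases s with i | j | j
    · ext s
      have := RingHom.map_mulVec Complex.ofRealHom (A.map (Int.cast : ℤ → ℝ)) (w i) s
      rw [hw, ← hcast] at this
      exact this.symm.trans (by simp [hW_def, hμ_def])
    · exact hu j
    · ext s
      have := RingHom.map_mulVec (starRingEnd ℂ) (A.map (Int.cast : ℤ → ℂ)) (u j) s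
      rw [hu, ← hconj] at this
      exact this.symm.trans (by simp [hW_def, hμ_def])
  have hWli : LinearIndependent ℂ W := linearIndependent_of_mulVec_eq_smul _ μ hμ W hW0 hW
  have e : Fin n ≃ Fin k ⊕ Fin l ⊕ Fin l := Fintype.equivOfCardEq (by simp; omega)
  have hdetW : (Matrix.of fun s t : Fin n => W (e t) s).det ≠ 0 := by
    rw [← isUnit_iff_ne_zero, ← Matrix.isUnit_iff_isUnit_det,
      ← Matrix.linearIndependent_cols_iff_isUnit]
    exact hWli.comp e e.injective
  have hdetV : (vandermonde (μ ∘ e)).det ≠ 0 :=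
    det_vandermonde_ne_zero_iff.mpr (hμ.comp e.injective)
  have hcomb (x : Fin k → ℝ) (y z : Fin l → ℝ) :=
    sum_complexCoord_smul w u x y z ((∑ i : Fin k, x i • realFrame hkl w u
      ⟨(i : ℕ), by have := i.isLt; omega⟩) + (∑ j : Fin l,
        (y j • realFrame hkl w u ⟨k + 2 * (j : ℕ), by have := j.isLt; omega⟩ +
         z j • realFrame hkl w u ⟨k + 2 * (j : ℕ) + 1, by have := j.isLt; omega⟩)))
      fun s => by simp [realFrame_left, realFrame_re, realFrame_im]
  refine ⟨realFrame hkl w u, ‖(Matrix.of fun s t : Fin n => W (e t) s).det‖ *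
    ‖(vandermonde (μ ∘ e)).det‖ / 4 ^ l, by positivity, ?_, ?_, ?_, ?_⟩
  · rw [Fintype.linearIndependent_iff]
    intro b hb
    rw [sum_eq_sum_add_sum_pairs hkl] at hb
    have h0 := hcomb (fun i => b ⟨i, by have := i.isLt; omega⟩)
      (fun j => b ⟨k + 2 * j, by have := j.isLt; omega⟩)
      (fun j => b ⟨k + 2 * j + 1, by have := j.isLt; omega⟩)
    rw [hb] at h0
    have h1 := Fintype.linearIndependent_iff.mp hWli _ (h0.trans (by ext; simp))
    intro t
    obtain ⟨i | ⟨j, b'⟩, rfl⟩ := (finPairsEquiv hkl).surjective t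
    · simpa [complexCoord, finPairsEquiv_inl] using h1 (.inl i)
    · have := h1 (.inr (.inl j))
      simp only [complexCoord, Sum.elim_inr, Sum.elim_inl, Complex.ext_iff] at this
      fin_cases b'
      · simpa [finPairsEquiv_inr_zero] using this.1
      · simpa [finPairsEquiv_inr_one] using this.2
  · intro i
    simpa only [realFrame_left] using hw i
  · intro j
    refine ⟨c j, him j, ?_⟩
    have : (fun t : Fin n =>
        ((realFrame hkl w u ⟨k + 2 * (j : ℕ), by have := j.isLt; omega⟩ t : ℝ) : ℂ) +
          Complex.I * ((realFrame hkl w u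
            ⟨k + 2 * (j : ℕ) + 1, by have := j.isLt; omega⟩ t : ℝ) : ℂ)) = u j := by
      ext t
      rw [realFrame_re, realFrame_im, mul_comm, Complex.re_add_im]
    rw [this, hu]
  · intro x y z
    have key := det_krylov_sum_smul e _ μ W hW (complexCoord x y z)
    rw [hcomb] at key
    rw [← Real.norm_eq_abs, ← Complex.norm_real, ← Complex.ofRealHom_eq_coe, RingHom.map_det]
    refine (congrArg norm ((congrArg det ?_).trans key)).trans ?_
    · ext s t
      rw [RingHom.mapMatrix_apply, Matrix.map_apply, of_apply, of_apply, RingHom.map_mulVec,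
        hcast, Matrix.map_pow]
      rfl
    · rw [norm_mul, norm_mul, norm_prod_complexCoord]
      ring
end

section
/- Fix a 3×3 Hessenberg type Ω and base matrix M₀ as in the context, with family H(m,n). For real (m,n) set M′(m,n) = a₂₃a₃₂ − a₁₁a₃₃ + a₁₂a₂₁ − a₂₂a₃₃ − a₁₁a₂₂ + a₂₁a₃₂·m − a₁₁a₃₂·n and N′(m,n) = a₁₁ + a₂₂ + a₃₃ + a₃₂·n. Then for all real (m,n), the characteristic polynomial of H(m,n) equals the characteristic polynomial of the Frobenius matrix [[0,0,1],[1,0,M′(m,n)],[0,1,N′(m,n)]], namely t³ − N′(m,n)t² − M′(m,n)t − 1. Consequently the discriminants are equal, and the invertible affine map (m,n) ↦ (M′(m,n), N′(m,n)) of ℝ² maps the curve {disc(charpoly H(m,n)) = 0} bijectively onto the curve {disc(t³ − n t² − m t − 1) = 0}. -/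
open Matrix Polynomial

/-- Discriminant of the monic cubic `t³ + p t² + q t + r`. -/
def cubicDisc (p q r : ℝ) : ℝ :=
  18 * p * q * r - 4 * p ^ 3 * r + p ^ 2 * q ^ 2 - 4 * q ^ 3 - 27 * r ^ 2

/-- Discriminant of the characteristic polynomial of a real 3×3 matrix. -/
def matDisc (M : Matrix (Fin 3) (Fin 3) ℝ) : ℝ :=
  cubicDisc (-(M 0 0 + M 1 1 + M 2 2))
    ((M 0 0 * M 1 1 - M 0 1 * M 1 0) + (M 0 0 * M 2 2 - M 0 2 * M 2 0) +
      (M 1 1 * M 2 2 - M 1 2 * M 2 1))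
    (-M.det)

/-- The real family `H(m,n)` of matrices of Hessenberg type
`⟨a₁₁,a₂₁|a₁₂,a₂₂,a₃₂⟩` with base third column `(a₁₃,a₂₃,a₃₃)`. -/
def Hfam (a11 a21 a12 a22 a32 a13 a23 a33 : ℝ) (m n : ℝ) : Matrix (Fin 3) (Fin 3) ℝ :=
  !![a11, a12, a13 + a11 * m + a12 * n;
     a21, a22, a23 + a21 * m + a22 * n;
     0,   a32, a33 + a32 * n]

/-- The characteristic polynomial of a 3×3 matrix in terms of its trace, principal minors and
determinant. -/
theorem charpoly_fin_three_eq {R : Type*} [CommRing R] (A : Matrix (Fin 3) (Fin 3) R) :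
    A.charpoly = X ^ 3 - C (A 0 0 + A 1 1 + A 2 2) * X ^ 2 +
      C ((A 0 0 * A 1 1 - A 0 1 * A 1 0) + (A 0 0 * A 2 2 - A 0 2 * A 2 0) +
        (A 1 1 * A 2 2 - A 1 2 * A 2 1)) * X - C A.det := by
  simp only [Matrix.charpoly, Matrix.det_fin_three, charmatrix_apply, map_add, map_sub, map_mul]
  simp [Matrix.diagonal]
  ring

/-- The determinant is constant along the family. -/
theorem det_Hfam (a11 a21 a12 a22 a32 a13 a23 a33 m n : ℝ) :
    (Hfam a11 a21 a12 a22 a32 a13 a23 a33 m n).det =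
      (!![a11, a12, a13; a21, a22, a23; 0, a32, a33] : Matrix (Fin 3) (Fin 3) ℝ).det := by
  simp [Hfam, Matrix.det_fin_three]
  ring

/-- with `M′(m,n)` and `N′(m,n)` as below, the characteristic polynomial
of `H(m,n)` equals `t³ − N′ t² − M′ t − 1`, that of the Frobenius matrix
`[[0,0,1],[1,0,M′],[0,1,N′]]`; consequently the discriminants are equal and the affine
map `(m,n) ↦ (M′,N′)` maps the curve `{disc charpoly H(m,n) = 0}` bijectively onto the
curve `{disc(t³ − n t² − m t − 1) = 0}`. -/
theorem statement10 (a11 a21 a12 a22 a32 a13 a23 a33 : ℤ)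
    (h21 : 1 ≤ a21) (h32 : 1 ≤ a32)
    (hdet : (!![a11, a12, a13; a21, a22, a23; 0, a32, a33] :
      Matrix (Fin 3) (Fin 3) ℤ).det = 1) :
    let M' : ℝ → ℝ → ℝ := fun m n =>
      (a23 : ℝ) * a32 - a11 * a33 + a12 * a21 - a22 * a33 - a11 * a22 +
        a21 * a32 * m - a11 * a32 * n
    let N' : ℝ → ℝ → ℝ := fun m n => (a11 : ℝ) + a22 + a33 + a32 * n
    (∀ m n : ℝ,
      (Hfam (a11 : ℝ) a21 a12 a22 a32 a13 a23 a33 m n).charpoly =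
        X ^ 3 - C (N' m n) * X ^ 2 - C (M' m n) * X - 1) ∧
    (∀ m n : ℝ,
      (!![0, 0, 1; 1, 0, M' m n; 0, 1, N' m n] : Matrix (Fin 3) (Fin 3) ℝ).charpoly =
        X ^ 3 - C (N' m n) * X ^ 2 - C (M' m n) * X - 1) ∧
    (∀ m n : ℝ,
      matDisc (Hfam (a11 : ℝ) a21 a12 a22 a32 a13 a23 a33 m n) =
        cubicDisc (-(N' m n)) (-(M' m n)) (-1)) ∧
    Set.BijOn (fun p : ℝ × ℝ => (M' p.1 p.2, N' p.1 p.2))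
      {p : ℝ × ℝ | matDisc (Hfam (a11 : ℝ) a21 a12 a22 a32 a13 a23 a33 p.1 p.2) = 0}
      {p : ℝ × ℝ | cubicDisc (-p.2) (-p.1) (-1) = 0} := by
  intro M' N'
  have h21' : (a21 : ℝ) ≠ 0 := by exact_mod_cast (by lia : a21 ≠ 0)
  have h32' : (a32 : ℝ) ≠ 0 := by exact_mod_cast (by lia : a32 ≠ 0)
  have det_eq_one (m n : ℝ) : (Hfam (a11 : ℝ) a21 a12 a22 a32 a13 a23 a33 m n).det = 1 := by
    rw [det_Hfam]
    simp only [Matrix.det_fin_three] at hdet ⊢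
    have h := congrArg (Int.cast : ℤ → ℝ) hdet
    simpa using h
  have disc_eq (m n : ℝ) : matDisc (Hfam (a11 : ℝ) a21 a12 a22 a32 a13 a23 a33 m n) =
      cubicDisc (-(N' m n)) (-(M' m n)) (-1) := by
    rw [matDisc, det_eq_one]
    congr 1
    · simp [Hfam, N']
      ring
    · simp [Hfam, M']
      ring
  refine ⟨fun m n => ?_, fun m n => ?_, disc_eq, ?_, ?_, ?_⟩
  · rw [charpoly_fin_three_eq, det_eq_one, sub_eq_add_neg _ (C (M' m n) * X), ← neg_mul, ← C_neg,
      C_1]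
    congr 4
    · simp [Hfam, N']
      ring
    · simp [Hfam, M']
      ring
  · rw [charpoly_fin_three_eq]
    simp [Matrix.det_fin_three, sub_eq_add_neg]
  · intro p hp
    simpa [disc_eq] using hp
  · rintro ⟨m, n⟩ - ⟨m', n'⟩ - h
    simp only [Prod.mk.injEq, M', N'] at h
    obtain ⟨hM, hN⟩ := h
    have hn : n = n' := mul_left_cancel₀ h32' (by linarith)
    subst hn
    have hm : m = m' := mul_left_cancel₀ (mul_ne_zero h21' h32') (by linarith)
    rw [hm]
  · rintro ⟨u, v⟩ huv
    obtain ⟨n, hn⟩ : ∃ n, ∀ m, N' m n = v :=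
      ⟨(v - a11 - a22 - a33) / a32, fun _ => by simp only [N']; field_simp; ring⟩
    obtain ⟨m, hm⟩ : ∃ m, M' m n = u :=
      ⟨(u - M' 0 n) / (a21 * a32), by simp only [M']; field_simp; ring⟩
    refine ⟨(m, n), ?_, by simp [hm, hn]⟩
    simpa [disc_eq, hm, hn] using huv
end

section
/- Fix a perfect 3×3 Hessenberg type Ω and base matrix M₀ as in the context, with integer family H(m,n) ⊂ SL(3,ℤ). Let d ∈ ℤ² be nonzero and (m₀,n₀) ∈ ℤ² be such that for every integer t ≥ 0 the matrix H((m₀,n₀) + t·d) is an NRS-matrix (an NRS-ray). Then there exists T such that for every integer t ≥ T the matrix H((m₀,n₀) + t·d) is a reduced perfect Hessenberg matrix; i.e., the ray contains only finitely many nonreduced matrices. -/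
open Matrix Polynomial

/-- Discriminant of the monic cubic `t³ + p t² + q t + r` (integer coefficients). -/
def cubicDiscZ (p q r : ℤ) : ℤ :=
  18 * p * q * r - 4 * p ^ 3 * r + p ^ 2 * q ^ 2 - 4 * q ^ 3 - 27 * r ^ 2

/-- Discriminant of the characteristic polynomial of an integer 3×3 matrix. -/
def matDiscZ (M : Matrix (Fin 3) (Fin 3) ℤ) : ℤ :=
  cubicDiscZ (-(M 0 0 + M 1 1 + M 2 2))
    ((M 0 0 * M 1 1 - M 0 1 * M 1 0) + (M 0 0 * M 2 2 - M 0 2 * M 2 0) +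
      (M 1 1 * M 2 2 - M 1 2 * M 2 1))
    (-M.det)

/-- NRS-matrix: irreducible characteristic polynomial over ℚ with one real root and two
complex-conjugate roots (equivalently, negative discriminant). -/
def IsNRS (M : Matrix (Fin 3) (Fin 3) ℤ) : Prop :=
  Irreducible ((M.charpoly).map (Int.castRingHom ℚ)) ∧ matDiscZ M < 0

/-- The integer family `H(m,n)` of matrices of Hessenberg type
`⟨a₁₁,a₂₁|a₁₂,a₂₂,a₃₂⟩` with base third column `(a₁₃,a₂₃,a₃₃)`. -/
def HfamZ (a11 a21 a12 a22 a32 a13 a23 a33 : ℤ) (m n : ℤ) : Matrix (Fin 3) (Fin 3) ℤ :=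
  !![a11, a12, a13 + a11 * m + a12 * n;
     a21, a22, a23 + a21 * m + a22 * n;
     0,   a32, a33 + a32 * n]

/-- The matrix with columns `v`, `M v`, `M² v`. -/
def krylov {R : Type*} [CommRing R] (M : Matrix (Fin 3) (Fin 3) R) (v : Fin 3 → R) :
    Matrix (Fin 3) (Fin 3) R :=
  Matrix.of fun i j => ((M ^ (j : ℕ)) *ᵥ v) i

theorem krylov_mulVec {R : Type*} [CommRing R] {M N Y : Matrix (Fin 3) (Fin 3) R}
    (h : M * Y = Y * N) (v : Fin 3 → R) : krylov M (Y *ᵥ v) = Y * krylov N v := by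
  ext i j
  have hs : SemiconjBy Y N M := h.symm
  have h1 : M ^ (j : ℕ) * Y = Y * N ^ (j : ℕ) := (hs.pow_right (j : ℕ)).eq.symm
  simp only [krylov, Matrix.of_apply, Matrix.mulVec_mulVec, h1, Matrix.mul_apply]
  rw [← Matrix.mulVec_mulVec]
  rfl

/-- The norm of `x + y θ + z θ²`, where `θ³ = τ θ² - σ θ + 1`. -/
def cubicNorm (τ σ x y z : ℝ) : ℝ :=
  x ^ 3 + τ * x ^ 2 * y + (τ ^ 2 - 2 * σ) * x ^ 2 * z + σ * x * y ^ 2 + (τ * σ - 3) * x * y * z +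
    (σ ^ 2 - 2 * τ) * x * z ^ 2 + y ^ 3 + τ * y ^ 2 * z + σ * y * z ^ 2 + z ^ 3

/-- The quadratic factor of `cubicNorm`, for a pair of roots with sum `s` and product `P`. -/
noncomputable def quadFactor (s P x y z : ℝ) : ℝ :=
  (x + s * (y + s * z) / 2 - P * z) ^ 2 + (P - s ^ 2 / 4) * (y + s * z) ^ 2

theorem cubicNorm_swap (τ σ x y z : ℝ) : cubicNorm τ σ x y z = cubicNorm σ τ z y x := by
  unfold cubicNorm; ring

theorem cubicNorm_eq_mul {s ρ P : ℝ} (h : ρ * P = 1) (x y z : ℝ) :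
    cubicNorm (s + ρ) (P + s * ρ) x y z
      = (x + y * ρ + z * ρ ^ 2) * quadFactor s P x y z := by
  unfold cubicNorm quadFactor
  linear_combination (2 * s * x * z ^ 2 + 3 * x * y * z + 2 * ρ * x * z ^ 2 - s * y ^ 2 * z
    - s * ρ * y * z ^ 2 - ρ * y ^ 2 * z - y * P * z ^ 2 - y ^ 3 - z ^ 3 * (1 + ρ * P)) * h

theorem linFactor_mul {s ρ P : ℝ} (h : ρ * P = 1) (x y z : ℝ) :
    z + (x - (P + s * ρ) * z) * ρ + (y + (s + ρ) * z) * ρ ^ 2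
      = (x + y * ρ + z * ρ ^ 2) * ρ := by
  linear_combination (-z) * h

theorem quadFactor_mul {s ρ P : ℝ} (h : ρ * P = 1) (x y z : ℝ) :
    quadFactor s P z (x - (P + s * ρ) * z) (y + (s + ρ) * z) = quadFactor s P x y z * P := by
  unfold quadFactor
  linear_combination (-(2 * z * (s * (x - P * z) / 2 + s ^ 2 * (y + s * z) / 2 - P * (y + s * z))
    + (1 - ρ * P) * z ^ 2)) * h

/-- A set of triples closed under multiplication by `θ` and `θ⁻¹`, where
`θ³ = τ θ² - σ θ + 1`. -/
structure RootStable (τ σ : ℝ) (L : ℝ → ℝ → ℝ → Prop) : Prop where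
  mul : ∀ x y z, L x y z → L z (x - σ * z) (y + τ * z)
  div : ∀ x y z, L x y z → L (y + σ * x) (z - τ * x) x

theorem RootStable.swap {τ σ : ℝ} {L : ℝ → ℝ → ℝ → Prop} (h : RootStable τ σ L) :
    RootStable σ τ fun x y z => L z y x :=
  ⟨fun x y z hL => h.div z y x hL, fun x y z hL => h.mul z y x hL⟩

theorem RootStable.exists_zpow {s ρ P : ℝ} (h : ρ * P = 1) {L : ℝ → ℝ → ℝ → Prop}
    (hL : RootStable (s + ρ) (P + s * ρ) L) {x y z : ℝ} (hxyz : L x y z) (k : ℤ) :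
    ∃ x' y' z', L x' y' z' ∧
      x + y * ρ + z * ρ ^ 2 = (x' + y' * ρ + z' * ρ ^ 2) * P ^ k ∧
      quadFactor s P x' y' z' = quadFactor s P x y z * P ^ k := by
  have hP : P ≠ 0 := right_ne_zero_of_mul_eq_one h
  induction k with
  | zero => exact ⟨x, y, z, hxyz, by simp, by simp⟩
  | succ n ih =>
    obtain ⟨x', y', z', h1, h2, h3⟩ := ih
    refine ⟨_, _, _, hL.mul _ _ _ h1, ?_, ?_⟩
    · rw [linFactor_mul h, h2, zpow_add_one₀ hP]
      linear_combination (-(x' + y' * ρ + z' * ρ ^ 2) * P ^ (n : ℤ)) * h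
    · rw [quadFactor_mul h, zpow_add_one₀ hP, ← mul_assoc, ← h3]
  | pred n ih =>
    obtain ⟨x', y', z', h1, h2, h3⟩ := ih
    refine ⟨_, _, _, hL.div _ _ _ h1, ?_, ?_⟩
    · have := linFactor_mul (s := s) h (y' + (P + s * ρ) * x') (z' - (s + ρ) * x') x'
      simp only [add_sub_cancel_right, sub_add_cancel] at this
      rw [h2, zpow_sub_one₀ hP, this, eq_inv_of_mul_eq_one_left h]
      ring
    · have := quadFactor_mul (s := s) h (y' + (P + s * ρ) * x') (z' - (s + ρ) * x') x'
      simp only [add_sub_cancel_right, sub_add_cancel] at this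
      rw [zpow_sub_one₀ hP, ← mul_assoc, ← h3, this, mul_inv_cancel_right₀ hP]

theorem RootStable.exists_balanced {s ρ P B : ℝ} (h : ρ * P = 1) (hP : 1 < P) (hB : 0 < B)
    {L : ℝ → ℝ → ℝ → Prop} (hL : RootStable (s + ρ) (P + s * ρ) L) {x y z : ℝ} (hxyz : L x y z)
    (hl : x + y * ρ + z * ρ ^ 2 ≠ 0) (hq : 0 < quadFactor s P x y z) :
    ∃ x' y' z', L x' y' z' ∧
      cubicNorm (s + ρ) (P + s * ρ) x' y' z' = cubicNorm (s + ρ) (P + s * ρ) x y z ∧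
      B ^ 3 * (x' + y' * ρ + z' * ρ ^ 2) ^ 2 ≤ quadFactor s P x' y' z' ∧
      quadFactor s P x' y' z' < B ^ 3 * P ^ 3 * (x' + y' * ρ + z' * ρ ^ 2) ^ 2 := by
  have hP0 : 0 < P := by linarith
  have hl2 : 0 < (x + y * ρ + z * ρ ^ 2) ^ 2 := by positivity
  obtain ⟨n, hn1, hn2⟩ := exists_mem_Ico_zpow
    (x := quadFactor s P x y z / (B ^ 3 * (x + y * ρ + z * ρ ^ 2) ^ 2)) (y := P ^ 3)
    (by positivity) (one_lt_pow₀ hP (by norm_num))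
  obtain ⟨x', y', z', h1, h2, h3⟩ := hL.exists_zpow h hxyz (-n)
  have hc : 0 < P ^ n := by positivity
  rw [_root_.zpow_neg, ← div_eq_mul_inv, eq_div_iff hc.ne'] at h2 h3
  have hpow : (P ^ 3) ^ n = (P ^ n) ^ 3 := by
    rw [← zpow_natCast, ← zpow_natCast, ← _root_.zpow_mul, ← _root_.zpow_mul, mul_comm]
  rw [hpow, le_div_iff₀ (by positivity)] at hn1
  rw [zpow_add_one₀ (by positivity), hpow, div_lt_iff₀ (by positivity)] at hn2
  refine ⟨x', y', z', h1, ?_, ?_, ?_⟩ <;> try rw [← h2]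
  · rw [cubicNorm_eq_mul h, cubicNorm_eq_mul h, ← h2, ← h3]
    ring
  · refine le_of_mul_le_mul_right ?_ hc
    rw [h3]
    linarith
  · refine lt_of_mul_lt_mul_right ?_ hc.le
    rw [h3]
    linarith

theorem eq_zero_of_mul_eq_intCast {D y : ℝ} (hD : 0 < D) (hy : |y| < 1 / D)
    (h : ∃ k : ℤ, D * y = k) : y = 0 := by
  obtain ⟨k, hk⟩ := h
  rw [lt_div_iff₀ hD] at hy
  have h1 : |(k : ℝ)| < 1 := by
    rw [← hk, abs_mul, abs_of_pos hD]
    linarith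
  have h2 : k = 0 := Int.abs_lt_one_iff.mp (by exact_mod_cast h1)
  rw [h2, Int.cast_zero] at hk
  exact (mul_eq_zero.mp hk).resolve_left hD.ne'

theorem RootStable.one_le_abs_cubicNorm {D S s ρ P : ℝ} (hD : 1 ≤ D) (hs : |s| ≤ S)
    (h : ρ * P = 1) (hP8 : 8 ≤ P) (hPS : S ^ 2 ≤ P) (hPS' : 4 * (S + 1) ≤ P)
    (hPD : 2 * D * (2 * D ^ 2 + 1 + S) < P)
    {L : ℝ → ℝ → ℝ → Prop} (hL : RootStable (s + ρ) (P + s * ρ) L)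
    (hy : ∀ x y z, L x y z → ∃ k : ℤ, D * y = k) (hz : ∀ x y z, L x y z → ∃ k : ℤ, D * z = k)
    (hx : ∀ x, L x 0 0 → ∃ k : ℤ, x = k) {x y z : ℝ} (hxyz : L x y z)
    (hne : cubicNorm (s + ρ) (P + s * ρ) x y z ≠ 0) :
    1 ≤ |cubicNorm (s + ρ) (P + s * ρ) x y z| := by
  by_contra! hlt
  have hS : 0 ≤ S := (abs_nonneg s).trans hs
  have hs2 : s ^ 2 ≤ P := (sq_le_sq' (by linarith [abs_le.mp hs]) (abs_le.mp hs).2).trans hPS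
  have hP0 : 0 < P := by linarith
  have hD0 : 0 < D := by linarith
  have hQ0 : ∀ x y z, 0 ≤ quadFactor s P x y z := fun x y z => by
    unfold quadFactor
    have : 0 ≤ P - s ^ 2 / 4 := by linarith
    positivity
  have hne' := hne
  rw [cubicNorm_eq_mul h, mul_ne_zero_iff] at hne'
  obtain ⟨x', y', z', hL', hN, hlow, hupp⟩ := hL.exists_balanced (B := 1 / (2 * D ^ 2)) h
    (by linarith) (by positivity) hxyz hne'.1 ((hQ0 x y z).lt_of_ne' hne'.2)
  rw [← hN] at hne hlt
  clear hne' hN hxyz x y z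
  obtain ⟨B, hB⟩ : ∃ B, B = 1 / (2 * D ^ 2) := ⟨_, rfl⟩
  rw [← hB] at hlow hupp
  have hB0 : 0 < B := by rw [hB]; positivity
  have hlt' := hlt
  rw [cubicNorm_eq_mul h, abs_mul, abs_of_nonneg (hQ0 _ _ _)] at hlt'
  obtain ⟨l, hl⟩ : ∃ l, l = x' + y' * ρ + z' * ρ ^ 2 := ⟨_, rfl⟩
  obtain ⟨Q, hQ⟩ : ∃ Q, Q = quadFactor s P x' y' z' := ⟨_, rfl⟩
  have hQ00 : 0 ≤ Q := hQ ▸ hQ0 _ _ _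
  rw [← hl, ← hQ] at hlow hupp hlt'
  have hl1 : |l| < 2 * D ^ 2 := by
    have h1 : (B * |l|) ^ 3 < 1 := by
      calc (B * |l|) ^ 3 = B ^ 3 * l ^ 2 * |l| := by rw [← sq_abs l]; ring
        _ ≤ Q * |l| := by gcongr
        _ < 1 := by linarith
    have h2 : B * |l| < 1 := (pow_lt_one_iff_of_nonneg (by positivity) (by norm_num)).mp h1
    rw [hB, div_mul_eq_mul_div, one_mul, div_lt_one (by positivity)] at h2
    exact h2
  have hQlt : Q < B * P := by
    have hQpos : 0 < Q := by
      refine hQ00.lt_of_ne' fun h0 => hne ?_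
      rw [cubicNorm_eq_mul h, ← hQ, h0, mul_zero]
    refine lt_of_pow_lt_pow_left₀ 3 (by positivity) ?_
    calc Q ^ 3 = Q * Q ^ 2 := by ring
      _ < B ^ 3 * P ^ 3 * l ^ 2 * Q ^ 2 := by gcongr
      _ = (B * P) ^ 3 * (|l| * Q) ^ 2 := by rw [mul_pow |l|, sq_abs]; ring
      _ ≤ (B * P) ^ 3 * 1 := by
        gcongr
        exact pow_le_one₀ (by positivity) hlt'.le
      _ = (B * P) ^ 3 := mul_one _
  obtain ⟨w, hw⟩ : ∃ w, w = y' + s * z' := ⟨_, rfl⟩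
  obtain ⟨a, ha⟩ : ∃ a, a = x' + s * w / 2 - P * z' := ⟨_, rfl⟩
  have hQaw : Q = a ^ 2 + (P - s ^ 2 / 4) * w ^ 2 := by
    rw [hQ, ha, hw, quadFactor]
  have hwlt : |w| < 1 / D := by
    refine abs_lt_of_sq_lt_sq ?_ (by positivity)
    have h1 : P / 2 * w ^ 2 < P / 2 * (1 / D) ^ 2 := by
      calc P / 2 * w ^ 2 ≤ (P - s ^ 2 / 4) * w ^ 2 := by gcongr; linarith
        _ ≤ Q := by rw [hQaw]; linarith [sq_nonneg a]
        _ < B * P := hQlt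
        _ = P / 2 * (1 / D) ^ 2 := by rw [hB]; field_simp
    exact lt_of_mul_lt_mul_left h1 (by positivity)
  have hD1 : 1 / D ≤ 1 := by rw [div_le_one hD0]; exact hD
  have halt : |a| < P / 4 * (1 / D) := by
    refine abs_lt_of_sq_lt_sq ?_ (by positivity)
    calc a ^ 2 ≤ Q := by
          rw [hQaw]
          have : 0 ≤ P - s ^ 2 / 4 := by linarith
          have : 0 ≤ (P - s ^ 2 / 4) * w ^ 2 := by positivity
          linarith
      _ < B * P := hQlt
      _ = 8 * P / 16 * (1 / D) ^ 2 := by rw [hB]; field_simp; norm_num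
      _ ≤ P * P / 16 * (1 / D) ^ 2 := by gcongr
      _ = (P / 4 * (1 / D)) ^ 2 := by ring
  have hρ0 : 0 < ρ := pos_of_mul_pos_left (h ▸ one_pos) hP0.le
  have hρ1 : ρ ≤ 1 := by nlinarith
  have hzlt : |z'| < 1 / D := by
    by_contra! hge
    have h1 : P * z' = l - w * ρ + s * ρ * z' - ρ ^ 2 * z' + s * w / 2 - a := by
      rw [ha, hl]; linear_combination ρ * hw
    have h2 : |w * ρ| ≤ 1 := by
      rw [abs_mul, abs_of_pos hρ0]
      exact mul_le_one₀ (hwlt.le.trans hD1) hρ0.le hρ1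
    have h3 : |s * ρ * z'| ≤ S * |z'| := by
      rw [abs_mul, abs_mul, abs_of_pos hρ0]
      gcongr
      calc |s| * ρ ≤ S * 1 := by gcongr
        _ = S := mul_one S
    have h4 : |ρ ^ 2 * z'| ≤ 1 * |z'| := by
      rw [abs_mul, abs_of_pos (by positivity)]
      gcongr
      exact pow_le_one₀ hρ0.le hρ1
    have h5 : |s * w / 2| ≤ S / 2 := by
      rw [abs_div, abs_mul, abs_two]
      gcongr
      calc |s| * |w| ≤ S * 1 := by gcongr; linarith
        _ = S := mul_one S
    have h6 : P * |z'| ≤ 2 * D ^ 2 + 1 + S * |z'| + |z'| + S / 2 + P / 4 * (1 / D) := by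
      rw [← abs_of_pos hP0, ← abs_mul, abs_of_pos hP0, h1, abs_le]
      rw [abs_le] at h2 h3 h4 h5
      rw [abs_lt] at hl1 halt
      constructor <;> linarith
    have h7 : (P / 4) * |z'| ≥ (S + 1) * |z'| := by gcongr; linarith
    have h8 : P * (1 / D) ≤ P * |z'| := by gcongr
    have h9 : (2 * D ^ 2 + 1 + S) < P * (1 / D) / 2 := by
      rw [mul_one_div, div_div, lt_div_iff₀ (by positivity)]
      linarith
    linarith
  have hz0 : z' = 0 := eq_zero_of_mul_eq_intCast hD0 hzlt (hz _ _ _ hL')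
  have hy0 : y' = 0 := by
    rw [hz0, mul_zero, add_zero] at hw
    exact eq_zero_of_mul_eq_intCast hD0 (hw ▸ hwlt) (hy _ _ _ hL')
  rw [hz0, hy0] at hL' hne hlt
  obtain ⟨k, hk⟩ := hx _ hL'
  have hNk : cubicNorm (s + ρ) (P + s * ρ) x' 0 0 = ((k ^ 3 : ℤ) : ℝ) := by
    rw [hk, cubicNorm]; push_cast; ring
  rw [hNk] at hne hlt
  have h1 : |k ^ 3| < 1 := by exact_mod_cast hlt
  exact hne (by rw [Int.abs_lt_one_iff.mp h1, Int.cast_zero])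

theorem exists_root_param (τ R : ℝ) : ∃ C : ℝ, ∀ σ, C ≤ σ →
    ∃ s ρ P : ℝ, ρ * P = 1 ∧ s + ρ = τ ∧ P + s * ρ = σ ∧ |s| ≤ |τ| + 1 ∧ R ≤ P := by
  refine ⟨8 + 8 * |τ| + 2 * |R|, fun σ hσ => ?_⟩
  have hτ0 := abs_nonneg τ
  have hR0 := abs_nonneg R
  have hσ0 : 0 < σ := by linarith
  let f : ℝ → ℝ := fun x => x ^ 3 - τ * x ^ 2 + σ * x - 1
  have hf : ContinuousOn f (Set.Icc 0 (2 / σ)) := by fun_prop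
  have hf1 : 0 ≤ f (2 / σ) := by
    have h1 : 4 * τ / σ ^ 2 ≤ 1 := by
      rw [div_le_one (by positivity)]
      nlinarith [le_abs_self τ]
    have h2 : f (2 / σ) = 8 / σ ^ 3 + (1 - 4 * τ / σ ^ 2) := by
      simp only [f]; field_simp; ring
    have h3 : 0 < 8 / σ ^ 3 := by positivity
    linarith
  obtain ⟨ρ, ⟨h0, h2⟩, hρ⟩ := intermediate_value_Icc (by positivity) hf
    (show (0 : ℝ) ∈ Set.Icc (f 0) (f (2 / σ)) from ⟨by simp [f], hf1⟩)
  simp only [f] at hρ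
  have hρ0 : 0 < ρ := h0.lt_of_ne (by rintro rfl; norm_num at hρ)
  have hρ1 : ρ ≤ 1 := h2.trans ((div_le_one hσ0).mpr (by linarith))
  rw [le_div_iff₀ hσ0] at h2
  refine ⟨τ - ρ, ρ, ρ⁻¹, mul_inv_cancel₀ hρ0.ne', by ring, ?_, ?_, ?_⟩
  · field_simp
    linarith
  · rw [abs_le]
    constructor <;> linarith [neg_abs_le τ, le_abs_self τ]
  · have h3 : σ / 2 ≤ ρ⁻¹ := by
      rw [le_inv_comm₀ (by positivity) hρ0, inv_div, le_div_iff₀ hσ0]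
      exact h2
    linarith [le_abs_self R]

theorem exists_one_le_abs_cubicNorm {D : ℝ} (hD : 1 ≤ D) (τ : ℝ) : ∃ C : ℝ, ∀ σ, C ≤ σ →
    ∀ L : ℝ → ℝ → ℝ → Prop, RootStable τ σ L →
    (∀ x y z, L x y z → ∃ k : ℤ, D * y = k) → (∀ x y z, L x y z → ∃ k : ℤ, D * z = k) →
    (∀ x, L x 0 0 → ∃ k : ℤ, x = k) → ∀ x y z, L x y z → cubicNorm τ σ x y z ≠ 0 →
    1 ≤ |cubicNorm τ σ x y z| := by
  obtain ⟨S, hS⟩ : ∃ S, S = |τ| + 1 := ⟨_, rfl⟩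
  have hS0 : 0 < S := by rw [hS]; positivity
  have hD0 : 0 < D := by linarith
  obtain ⟨C, hC⟩ := exists_root_param τ
    (8 + S ^ 2 + 4 * (S + 1) + (2 * D * (2 * D ^ 2 + 1 + S)))
  refine ⟨C, fun σ hσ L hL hy hz hx x y z hxyz hne => ?_⟩
  obtain ⟨s, ρ, P, h, rfl, rfl, hs, hP⟩ := hC σ hσ
  rw [← hS] at hs
  have h1 : 0 < 2 * D * (2 * D ^ 2 + 1 + S) := by positivity
  have h2 : 0 < S ^ 2 := by positivity
  exact hL.one_le_abs_cubicNorm hD hs h (by linarith) (by linarith) (by linarith) (by linarith)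
    hy hz hx hxyz hne

/-- The coordinates of the integer vectors in the basis `e₁, M e₁, M² e₁`, where `M` is a matrix
with first two columns `(a11, a21, 0)` and `(a12, a22, a32)`. -/
def HessLattice (a11 a21 a12 a22 a32 : ℤ) (x y z : ℝ) : Prop :=
  ∃ v0 v1 v2 : ℤ, x + a11 * y + (a11 ^ 2 + a12 * a21) * z = v0 ∧
    a21 * y + a21 * (a11 + a22) * z = v1 ∧ a21 * a32 * z = v2

theorem cast_det_eq_one {a11 a21 a12 a22 a32 b13 b23 b33 : ℤ}
    (hdet : (!![a11, a12, b13; a21, a22, b23; 0, a32, b33]).det = 1) :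
    (a11 * a22 * b33 - a11 * b23 * a32 - a12 * a21 * b33 + b13 * a21 * a32 : ℝ) = 1 := by
  simp [Matrix.det_fin_three] at hdet
  exact_mod_cast hdet

theorem hessLattice_rootStable {a11 a21 a12 a22 a32 b13 b23 b33 : ℤ}
    (hdet : (!![a11, a12, b13; a21, a22, b23; 0, a32, b33]).det = 1) :
    RootStable ((a11 + a22 + b33 : ℤ) : ℝ)
      ((a11 * a22 - a12 * a21 + (a11 + a22) * b33 - a32 * b23 : ℤ) : ℝ)
      (HessLattice a11 a21 a12 a22 a32) := by
  have hd := cast_det_eq_one hdet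
  constructor
  · rintro x y z ⟨v0, v1, v2, h0, h1, h2⟩
    refine ⟨a11 * v0 + a12 * v1 + b13 * v2, a21 * v0 + a22 * v1 + b23 * v2,
      a32 * v1 + b33 * v2, ?_, ?_, ?_⟩
    · push_cast
      linear_combination a11 * h0 + a12 * h1 + b13 * h2 - z * hd
    · push_cast
      linear_combination a21 * h0 + a22 * h1 + b23 * h2
    · push_cast
      linear_combination a32 * h1 + b33 * h2
  · rintro x y z ⟨v0, v1, v2, h0, h1, h2⟩
    refine ⟨(a22 * b33 - b23 * a32) * v0 - (a12 * b33 - b13 * a32) * v1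
        + (a12 * b23 - b13 * a22) * v2,
      -(a21 * b33) * v0 + a11 * b33 * v1 - (a11 * b23 - b13 * a21) * v2,
      a21 * a32 * v0 - a11 * a32 * v1 + (a11 * a22 - a12 * a21) * v2, ?_, ?_, ?_⟩
    · push_cast
      linear_combination (a22 * b33 - b23 * a32 : ℝ) * h0 - (a12 * b33 - b13 * a32 : ℝ) * h1
        + (a12 * b23 - b13 * a22 : ℝ) * h2 - (y + a11 * z) * hd
    · push_cast
      linear_combination (-(a21 * b33) : ℝ) * h0 + (a11 * b33 : ℝ) * h1
        - (a11 * b23 - b13 * a21 : ℝ) * h2 - a21 * z * hd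
    · push_cast
      linear_combination (a21 * a32 : ℝ) * h0 - (a11 * a32 : ℝ) * h1
        + (a11 * a22 - a12 * a21 : ℝ) * h2

theorem HessLattice.exists_intCast {a11 a21 a12 a22 a32 : ℤ} {x y z : ℝ}
    (h : HessLattice a11 a21 a12 a22 a32 x y z) :
    (∃ k : ℤ, ((a21 * a32 : ℤ) : ℝ) * x = k) ∧ (∃ k : ℤ, ((a21 * a32 : ℤ) : ℝ) * y = k) ∧
      ∃ k : ℤ, ((a21 * a32 : ℤ) : ℝ) * z = k := by
  obtain ⟨v0, v1, v2, h0, h1, h2⟩ := h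
  refine ⟨⟨a21 * a32 * v0 - a11 * (a32 * v1 - (a11 + a22) * v2) - (a11 ^ 2 + a12 * a21) * v2, ?_⟩,
    ⟨a32 * v1 - (a11 + a22) * v2, ?_⟩, ⟨v2, ?_⟩⟩
  · push_cast
    linear_combination (a21 * a32 : ℝ) * h0 - a11 * (a32 * h1 - (a11 + a22) * h2)
      - (a11 ^ 2 + a12 * a21) * h2
  · push_cast
    linear_combination (a32 : ℝ) * h1 - (a11 + a22) * h2
  · push_cast
    exact h2

theorem HessLattice.exists_eq_intCast {a11 a21 a12 a22 a32 : ℤ} {x : ℝ}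
    (h : HessLattice a11 a21 a12 a22 a32 x 0 0) : ∃ k : ℤ, x = k := by
  obtain ⟨v0, v1, v2, h0, h1, h2⟩ := h
  exact ⟨v0, by simpa using h0⟩

theorem det_krylov_eq {a11 a21 a12 a22 a32 b13 b23 b33 : ℤ} (h21 : 0 < a21) (h32 : 0 < a32)
    (hdet : (!![a11, a12, b13; a21, a22, b23; 0, a32, b33]).det = 1) (v : Fin 3 → ℤ) :
    ∃ x y z : ℝ, HessLattice a11 a21 a12 a22 a32 x y z ∧
      (((krylov !![a11, a12, b13; a21, a22, b23; 0, a32, b33] v).det : ℤ) : ℝ) =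
        a21 ^ 2 * a32 * cubicNorm ((a11 + a22 + b33 : ℤ) : ℝ)
          ((a11 * a22 - a12 * a21 + (a11 + a22) * b33 - a32 * b23 : ℤ) : ℝ) x y z := by
  have hd := cast_det_eq_one hdet
  have h21' : (0 : ℝ) < a21 := by exact_mod_cast h21
  have h32' : (0 : ℝ) < a32 := by exact_mod_cast h32
  set τ : ℝ := ((a11 + a22 + b33 : ℤ) : ℝ) with hτ
  set σ : ℝ := ((a11 * a22 - a12 * a21 + (a11 + a22) * b33 - a32 * b23 : ℤ) : ℝ) with hσ
  obtain ⟨z, hz⟩ : ∃ z : ℝ, a21 * a32 * z = v 2 := ⟨v 2 / (a21 * a32), by field_simp⟩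
  obtain ⟨y, hy⟩ : ∃ y : ℝ, a21 * y + a21 * (a11 + a22) * z = v 1 :=
    ⟨(v 1 - a21 * (a11 + a22) * z) / a21, by field_simp; ring⟩
  obtain ⟨x, hx⟩ : ∃ x : ℝ, x + a11 * y + (a11 ^ 2 + a12 * a21) * z = v 0 :=
    ⟨v 0 - a11 * y - (a11 ^ 2 + a12 * a21) * z, by ring⟩
  refine ⟨x, y, z, ⟨v 0, v 1, v 2, hx, hy, hz⟩, ?_⟩
  let M : Matrix (Fin 3) (Fin 3) ℝ := !![a11, a12, b13; a21, a22, b23; 0, a32, b33]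
  let K : Matrix (Fin 3) (Fin 3) ℝ :=
    !![1, a11, a11 ^ 2 + a12 * a21; 0, a21, a21 * (a11 + a22); 0, 0, a21 * a32]
  let F : Matrix (Fin 3) (Fin 3) ℝ := !![0, 0, 1; 1, 0, -σ; 0, 1, τ]
  have hMK : M * K = K * F := by
    ext i j
    fin_cases i <;> fin_cases j <;>
      simp [M, K, F, Matrix.mul_apply, Fin.sum_univ_three, hτ, hσ] <;> try ring1
    linear_combination hd
  have hv : (fun i => (v i : ℝ)) = K *ᵥ ![x, y, z] := by
    ext i
    fin_cases i
    · simp [K, Matrix.mulVec, dotProduct, Fin.sum_univ_three, ← hx]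
    · simp [K, Matrix.mulVec, dotProduct, Fin.sum_univ_three, ← hy]
    · simp [K, Matrix.mulVec, dotProduct, Fin.sum_univ_three, ← hz]
  have hcast : ((krylov !![a11, a12, b13; a21, a22, b23; 0, a32, b33] v).det : ℝ)
      = (krylov M fun i => (v i : ℝ)).det := by
    have hM : M = (!![a11, a12, b13; a21, a22, b23; 0, a32, b33]).map (Int.castRingHom ℝ) := by
      ext i j
      fin_cases i <;> fin_cases j <;> simp [M]
    change Int.castRingHom ℝ _ = _
    rw [RingHom.map_det, hM]
    congr 1
    ext i j
    simp only [krylov, RingHom.mapMatrix_apply, Matrix.map_apply, Matrix.of_apply]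
    rw [RingHom.map_mulVec, ← RingHom.mapMatrix_apply, ← RingHom.mapMatrix_apply, map_pow]
    rfl
  rw [hcast, hv, krylov_mulVec hMK, Matrix.det_mul]
  have hK : K.det = a21 ^ 2 * a32 := by
    simp [K, Matrix.det_fin_three]; ring
  have hF : (krylov F ![x, y, z]).det = cubicNorm τ σ x y z := by
    simp [krylov, F, Matrix.det_fin_three, pow_two, Matrix.mulVec, dotProduct,
      Fin.sum_univ_three, Matrix.mul_apply, cubicNorm]
    ring
  rw [hK, hF]

theorem hessComplexity_fin_three (M : Matrix (Fin 3) (Fin 3) ℤ) :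
    hessComplexity M = |M 1 0| ^ 2 * |M 2 1| := by
  simp [hessComplexity, subdiag, Finset.prod_range_succ]

theorem IsPerfect.hessComplexity_pos {M : Matrix (Fin 3) (Fin 3) ℤ} (h : IsPerfect M) :
    0 < hessComplexity M := by
  have h1 := h.2.2.2 0 0 le_rfl (by simp)
  have h2 := h.2.2.2 0 1 (by simp) (by simp)
  simp [subdiag] at h1 h2
  have h10 : 0 < M 1 0 := by linarith
  have h21 : 0 < M 2 1 := by linarith
  rw [hessComplexity_fin_three]
  positivity

theorem IntegerConjugate.exists_hessComplexity_eq {W M : Matrix (Fin 3) (Fin 3) ℤ}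
    (h : IntegerConjugate W M) (hM : IsHessenberg M) :
    ∃ v : Fin 3 → ℤ, hessComplexity M = |(krylov W v).det| := by
  obtain ⟨X, hX, hXW⟩ := h
  have hWY : W * X⁻¹ = X⁻¹ * M := by
    calc W * X⁻¹ = X⁻¹ * (X * W) * X⁻¹ := by
          rw [← Matrix.mul_assoc, Matrix.nonsing_inv_mul _ hX, Matrix.one_mul]
      _ = X⁻¹ * M := by
          rw [hXW, Matrix.mul_assoc, Matrix.mul_assoc, Matrix.mul_nonsing_inv _ hX, Matrix.mul_one]
  refine ⟨X⁻¹ *ᵥ ![1, 0, 0], ?_⟩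
  have hY : |(X⁻¹).det| = 1 := by
    rw [← Int.isUnit_iff_abs_eq]
    exact Matrix.isUnit_nonsing_inv_det _ hX
  have h20 : M 2 0 = 0 := hM 2 0 (by simp)
  rw [krylov_mulVec hWY, Matrix.det_mul, abs_mul, hY, one_mul, hessComplexity_fin_three,
    ← abs_pow, ← abs_mul]
  congr 1
  simp [krylov, Matrix.det_fin_three, pow_two, Matrix.mulVec, dotProduct,
      Fin.sum_univ_three, Matrix.mul_apply, h20]
  ring

theorem IsPerfect.isReducedHess {a11 a21 a12 a22 a32 b13 b23 b33 : ℤ} (h21 : 0 < a21)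
    (h32 : 0 < a32) (h : IsPerfect !![a11, a12, b13; a21, a22, b23; 0, a32, b33])
    (hN : ∀ x y z, HessLattice a11 a21 a12 a22 a32 x y z →
      cubicNorm ((a11 + a22 + b33 : ℤ) : ℝ)
        ((a11 * a22 - a12 * a21 + (a11 + a22) * b33 - a32 * b23 : ℤ) : ℝ) x y z ≠ 0 →
      1 ≤ |cubicNorm ((a11 + a22 + b33 : ℤ) : ℝ)
        ((a11 * a22 - a12 * a21 + (a11 + a22) * b33 - a32 * b23 : ℤ) : ℝ) x y z|) :
    IsReducedHess !![a11, a12, b13; a21, a22, b23; 0, a32, b33] := by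
  refine ⟨h, fun M hM hconj => ?_⟩
  obtain ⟨v, hv⟩ := hconj.exists_hessComplexity_eq hM.2.1
  obtain ⟨x, y, z, hL, hdet⟩ := det_krylov_eq h21 h32 h.1 v
  have hne : (krylov !![a11, a12, b13; a21, a22, b23; 0, a32, b33] v).det ≠ 0 := by
    rw [← abs_pos, ← hv]
    exact hM.hessComplexity_pos
  have hne' : (((krylov !![a11, a12, b13; a21, a22, b23; 0, a32, b33] v).det : ℤ) : ℝ) ≠ 0 := by
    exact_mod_cast hne
  rw [hdet] at hne'
  have hle := hN x y z hL (right_ne_zero_of_mul hne')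
  have hW : hessComplexity !![a11, a12, b13; a21, a22, b23; 0, a32, b33] = a21 ^ 2 * a32 := by
    simp [hessComplexity_fin_three, abs_of_pos h32]
  have h21' : (0 : ℝ) < a21 := by exact_mod_cast h21
  have h32' : (0 : ℝ) < a32 := by exact_mod_cast h32
  rw [hW, hv, ← Int.cast_le (R := ℝ), Int.cast_abs, hdet, abs_mul,
    abs_of_pos (by positivity : (0 : ℝ) < a21 ^ 2 * a32)]
  push_cast at hle ⊢
  exact le_mul_of_one_le_right (by positivity) hle

theorem exists_quartic_nonneg {c₄ : ℤ} (h : 0 < c₄) (c₃ c₂ c₁ c₀ : ℤ) :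
    ∃ t : ℤ, 0 < t ∧ 0 ≤ c₄ * t ^ 4 + c₃ * t ^ 3 + c₂ * t ^ 2 + c₁ * t + c₀ := by
  obtain ⟨t, ht⟩ : ∃ t, t = 1 + |c₃| + |c₂| + |c₁| + |c₀| := ⟨_, rfl⟩
  have h1 : 1 ≤ t := by
    rw [ht]
    linarith [abs_nonneg c₃, abs_nonneg c₂, abs_nonneg c₁, abs_nonneg c₀]
  refine ⟨t, by linarith, ?_⟩
  have bound : ∀ (c : ℤ) (k : ℕ), k ≤ 3 → -(|c| * t ^ 3) ≤ c * t ^ k := fun c k hk => by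
    calc -(|c| * t ^ 3) ≤ -(|c| * t ^ k) := by gcongr
      _ ≤ c * t ^ k := by
        have : 0 ≤ t ^ k := by positivity
        nlinarith [neg_abs_le c]
  have b3 := bound c₃ 3 (by norm_num)
  have b2 := bound c₂ 2 (by norm_num)
  have b1 := bound c₁ 1 (by norm_num)
  have b0 := bound c₀ 0 (by norm_num)
  have h3 : 0 ≤ t ^ 3 := by positivity
  have b4 : 1 * t ^ 4 ≤ c₄ * t ^ 4 := by gcongr; exact h
  have h4 : t ^ 4 = (1 + |c₃| + |c₂| + |c₁| + |c₀|) * t ^ 3 := by rw [← ht]; ring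
  simp only [pow_one, pow_zero, mul_one] at b1 b0
  linarith

theorem direction_of_cubicDiscZ_neg {τ σ u w : ℤ} (huw : u ≠ 0 ∨ w ≠ 0)
    (h : ∀ t : ℤ, 0 ≤ t → cubicDiscZ (-(τ + t * u)) (σ + t * w) (-1) < 0) :
    (u = 0 ∧ 0 < w) ∨ (w = 0 ∧ 0 < u) := by
  obtain ⟨c₃, h3⟩ : ∃ c, c = 2 * τ * u * w ^ 2 + 2 * σ * w * u ^ 2 - 4 * u ^ 3 - 4 * w ^ 3 :=
    ⟨_, rfl⟩
  obtain ⟨c₂, h2⟩ : ∃ c, c = τ ^ 2 * w ^ 2 + 4 * τ * σ * u * w + σ ^ 2 * u ^ 2 + 18 * u * w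
    - 12 * τ * u ^ 2 - 12 * σ * w ^ 2 := ⟨_, rfl⟩
  obtain ⟨c₁, h1⟩ : ∃ c, c = 2 * τ ^ 2 * σ * w + 2 * τ * u * σ ^ 2 + 18 * (τ * w + σ * u)
    - 12 * τ ^ 2 * u - 12 * σ ^ 2 * w := ⟨_, rfl⟩
  obtain ⟨c₀, h0⟩ : ∃ c, c = cubicDiscZ (-τ) σ (-1) := ⟨_, rfl⟩
  have hexp : ∀ t, cubicDiscZ (-(τ + t * u)) (σ + t * w) (-1)
      = u ^ 2 * w ^ 2 * t ^ 4 + c₃ * t ^ 3 + c₂ * t ^ 2 + c₁ * t + c₀ := fun t => by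
    rw [h3, h2, h1, h0]; unfold cubicDiscZ; ring
  have hprod : u = 0 ∨ w = 0 := by
    by_contra! hne
    obtain ⟨hu, hw⟩ := hne
    obtain ⟨t, ht, hle⟩ := exists_quartic_nonneg (c₄ := u ^ 2 * w ^ 2) (by positivity) c₃ c₂ c₁ c₀
    have := h t ht.le
    rw [hexp] at this
    linarith
  have hc₃ : c₃ ≤ 0 := by
    by_contra! hpos
    obtain ⟨t, ht, hle⟩ := exists_quartic_nonneg hpos c₂ c₁ c₀ 0
    have h4 := h t ht.le
    have h5 : u ^ 2 * w ^ 2 = 0 := by rcases hprod with h | h <;> simp [h]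
    rw [hexp, h5] at h4
    nlinarith
  rcases hprod with rfl | rfl
  · left
    refine ⟨rfl, ?_⟩
    have hw : w ≠ 0 := by simpa using huw
    have : 0 ≤ w ^ 3 := by linarith
    exact ((Odd.pow_nonneg_iff (by decide)).mp this).lt_of_ne' hw
  · right
    refine ⟨rfl, ?_⟩
    have hu : u ≠ 0 := by simpa using huw
    have : 0 ≤ u ^ 3 := by linarith
    exact ((Odd.pow_nonneg_iff (by decide)).mp this).lt_of_ne' hu

theorem exists_le_add_mul {w : ℤ} (hw : 0 < w) (C : ℝ) (σ : ℤ) :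
    ∃ T : ℤ, 0 ≤ T ∧ ∀ t, T ≤ t → C ≤ ((σ + t * w : ℤ) : ℝ) := by
  refine ⟨|⌈C⌉ - σ|, abs_nonneg _, fun t ht => ?_⟩
  have h0 : 0 ≤ t := (abs_nonneg _).trans ht
  have h1 : t * 1 ≤ t * w := by gcongr; exact hw
  have h2 : ⌈C⌉ ≤ σ + t * w := by linarith [le_abs_self (⌈C⌉ - σ)]
  exact Int.ceil_le.mp h2

theorem exists_forall_one_le_abs_cubicNorm {a11 a21 a12 a22 a32 τ σ u w : ℤ} (h21 : 0 < a21)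
    (h32 : 0 < a32) (huw : (u = 0 ∧ 0 < w) ∨ (w = 0 ∧ 0 < u))
    (hL : ∀ t : ℤ, RootStable ((τ + t * u : ℤ) : ℝ) ((σ + t * w : ℤ) : ℝ)
      (HessLattice a11 a21 a12 a22 a32)) :
    ∃ T : ℤ, 0 ≤ T ∧ ∀ t, T ≤ t → ∀ x y z, HessLattice a11 a21 a12 a22 a32 x y z →
      cubicNorm ((τ + t * u : ℤ) : ℝ) ((σ + t * w : ℤ) : ℝ) x y z ≠ 0 →
      1 ≤ |cubicNorm ((τ + t * u : ℤ) : ℝ) ((σ + t * w : ℤ) : ℝ) x y z| := by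
  have hD : (1 : ℝ) ≤ ((a21 * a32 : ℤ) : ℝ) := by
    exact_mod_cast Int.add_one_le_of_lt (mul_pos h21 h32)
  rcases huw with ⟨rfl, hw⟩ | ⟨rfl, hu⟩
  · simp only [mul_zero, add_zero] at hL ⊢
    obtain ⟨C, hC⟩ := exists_one_le_abs_cubicNorm hD τ
    obtain ⟨T, hT0, hT⟩ := exists_le_add_mul hw C σ
    exact ⟨T, hT0, fun t ht => hC _ (hT t ht) _ (hL t) (fun _ _ _ h => h.exists_intCast.2.1)
      (fun _ _ _ h => h.exists_intCast.2.2) (fun _ h => h.exists_eq_intCast)⟩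
  · simp only [mul_zero, add_zero] at hL ⊢
    obtain ⟨C, hC⟩ := exists_one_le_abs_cubicNorm hD σ
    obtain ⟨T, hT0, hT⟩ := exists_le_add_mul hu C τ
    refine ⟨T, hT0, fun t ht x y z hxyz => ?_⟩
    rw [cubicNorm_swap]
    refine hC _ (hT t ht) _ (hL t).swap (fun _ _ _ h => h.exists_intCast.2.1)
      (fun _ _ _ h => h.exists_intCast.1) (fun z h => ?_) z y x hxyz
    have h1 := (hL t).div _ _ _ h
    simp only [mul_zero, add_zero, sub_zero] at h1
    have h2 := (hL t).div _ _ _ h1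
    simp only [mul_zero, add_zero, sub_zero] at h2
    exact h2.exists_eq_intCast

/-- for a perfect Hessenberg type, any NRS-ray (an integer ray all of
whose matrices are NRS-matrices) contains only finitely many nonreduced matrices:
from some moment on all its matrices are reduced perfect Hessenberg matrices. -/
theorem statement11 (a11 a21 a12 a22 a32 a13 a23 a33 : ℤ)
    (h11 : 0 ≤ a11) (h11' : a11 < a21) (h12 : 0 ≤ a12) (h12' : a12 < a32)
    (h22 : 0 ≤ a22) (h22' : a22 < a32)
    (hdet : (HfamZ a11 a21 a12 a22 a32 a13 a23 a33 0 0).det = 1)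
    (d : ℤ × ℤ) (hd : d ≠ 0) (m₀ n₀ : ℤ)
    (hray : ∀ t : ℤ, 0 ≤ t →
      IsNRS (HfamZ a11 a21 a12 a22 a32 a13 a23 a33 (m₀ + t * d.1) (n₀ + t * d.2))) :
    ∃ T : ℤ, ∀ t : ℤ, T ≤ t →
      IsReducedHess (HfamZ a11 a21 a12 a22 a32 a13 a23 a33 (m₀ + t * d.1) (n₀ + t * d.2)) := by
  obtain ⟨d1, d2⟩ := d
  have h21 : 0 < a21 := by linarith
  have h32 : 0 < a32 := by linarith
  dsimp only at hray ⊢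
  have hdet' : ∀ m n, (HfamZ a11 a21 a12 a22 a32 a13 a23 a33 m n).det = 1 := fun m n => by
    rw [← hdet]
    simp [HfamZ, Matrix.det_fin_three]
    ring
  have hτ : ∀ t : ℤ, a11 + a22 + (a33 + a32 * (n₀ + t * d2))
      = (a11 + a22 + a33 + a32 * n₀) + t * (a32 * d2) := fun t => by ring
  have hσ : ∀ t : ℤ, a11 * a22 - a12 * a21 + (a11 + a22) * (a33 + a32 * (n₀ + t * d2))
        - a32 * (a23 + a21 * (m₀ + t * d1) + a22 * (n₀ + t * d2))
      = (a11 * a22 - a12 * a21 + (a11 + a22) * (a33 + a32 * n₀)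
        - a32 * (a23 + a21 * m₀ + a22 * n₀)) + t * (a32 * (a11 * d2 - a21 * d1)) :=
    fun t => by ring
  have huw := direction_of_cubicDiscZ_neg (τ := a11 + a22 + a33 + a32 * n₀)
    (σ := a11 * a22 - a12 * a21 + (a11 + a22) * (a33 + a32 * n₀)
      - a32 * (a23 + a21 * m₀ + a22 * n₀)) (u := a32 * d2) (w := a32 * (a11 * d2 - a21 * d1))
    (by
      by_contra! h
      obtain ⟨hu, hw⟩ := h
      have hd2 : d2 = 0 := (mul_eq_zero.mp hu).resolve_left h32.ne'
      have hd1 : d1 = 0 := by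
        have := (mul_eq_zero.mp hw).resolve_left h32.ne'
        rw [hd2, mul_zero, zero_sub, neg_eq_zero] at this
        exact (mul_eq_zero.mp this).resolve_left h21.ne'
      exact hd (by rw [hd1, hd2]; rfl))
    (fun t ht => by
      have h := (hray t ht).2
      rw [matDiscZ, hdet'] at h
      rw [← hτ, ← hσ]
      convert h using 2
      · simp [HfamZ]
      · simp [HfamZ]; ring)
  obtain ⟨T, hT0, hT⟩ := exists_forall_one_le_abs_cubicNorm h21 h32 huw fun t => by
    rw [← hτ, ← hσ]
    exact hessLattice_rootStable (hdet' _ _)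
  refine ⟨T, fun t ht => IsPerfect.isReducedHess h21 h32 ⟨hdet' _ _, ?_,
    (hray t (hT0.trans ht)).1, ?_⟩ ?_⟩
  · intro i j hij
    fin_cases i <;> fin_cases j <;> simp at hij ⊢
  · intro i j hij hj
    fin_cases i <;> fin_cases j <;> simp [subdiag] at hij hj ⊢ <;> constructor <;> linarith
  · rw [hτ, hσ]
    exact hT t ht
end
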